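/- arXiv:2603.05775 — 4 statements merged into one kernel-verified Lean document; each statement's English description precedes it below -/
import Mathlib

section
/- Let G be a finite simple 2-connected outerplanar graph containing exactly two triangles, and suppose G has no subgraph isomorphic to the diamond (K₄ minus one edge). Then for any two nonadjacent vertices u, v of G, every assignment of colors from a 3-element color set to u and v extends to a proper 3-coloring of G. -/
/-- `G` has an `H`-minor: there are pairwise disjoint branch sets in `G`,
each inducing a connected subgraph, with an edge of `G` between the branch sets
corresponding to each edge of `H`. -/
def SimpleGraph.HasMinor {V : Type*} {W : Type*} (G : SimpleGraph V) (H : SimpleGraph W) : Prop :=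
  ∃ f : W → Set V,
    (∀ w, (G.induce (f w)).Connected) ∧
    (Pairwise fun w₁ w₂ => Disjoint (f w₁) (f w₂)) ∧
    (∀ ⦃w₁ w₂⦄, H.Adj w₁ w₂ → ∃ a ∈ f w₁, ∃ b ∈ f w₂, G.Adj a b)

/-- A graph is outerplanar iff it has no `K₄` minor and no `K_{2,3}` minor. -/
def SimpleGraph.Outerplanar {V : Type*} (G : SimpleGraph V) : Prop :=
  ¬ G.HasMinor (completeGraph (Fin 4)) ∧
  ¬ G.HasMinor (completeBipartiteGraph (Fin 2) (Fin 3))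

/-- A graph is 2-connected if it has at least 3 vertices and deleting any single
vertex leaves it connected. -/
def SimpleGraph.TwoConnected {V : Type*} [Fintype V] (G : SimpleGraph V) : Prop :=
  3 ≤ Fintype.card V ∧ ∀ v : V, (G.induce ({v}ᶜ : Set V)).Connected

/-- The diamond graph: `K₄` minus the edge `{0, 1}` (two triangles sharing the edge `{2, 3}`).
Its two nonadjacent (diamond) vertices are `0` and `1`. -/
def diamondGraph : SimpleGraph (Fin 4) :=
  SimpleGraph.fromEdgeSet {s(0, 2), s(0, 3), s(1, 2), s(1, 3), s(2, 3)}

/-- An (embedded) copy of the diamond as a subgraph of `G`: an injective map from the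
diamond's vertices preserving adjacency. -/
def IsDiamondCopy {V : Type*} (G : SimpleGraph V) (f : Fin 4 → V) : Prop :=
  Function.Injective f ∧ ∀ ⦃a b : Fin 4⦄, diamondGraph.Adj a b → G.Adj (f a) (f b)

namespace SimpleGraph

variable {V : Type*}

/-- The graph obtained from `G` by removing all edges at `x`. -/
def isolate (G : SimpleGraph V) (x : V) : SimpleGraph V where
  Adj a b := G.Adj a b ∧ a ≠ x ∧ b ≠ x
  symm := ⟨fun _ _ h => ⟨h.1.symm, h.2.2, h.2.1⟩⟩
  loopless := ⟨fun _ h => h.1.ne rfl⟩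

/-- The graph obtained from `G` by merging `x` into `y`; the vertex `x` becomes isolated. -/
def mergeInto (G : SimpleGraph V) (x y : V) : SimpleGraph V where
  Adj a b := a ≠ b ∧ a ≠ x ∧ b ≠ x ∧
    (G.Adj a b ∨ (a = y ∧ G.Adj x b) ∨ (b = y ∧ G.Adj x a))
  symm := ⟨fun a b h => by
    obtain ⟨h₁, h₂, h₃, h₄⟩ := h
    refine ⟨h₁.symm, h₃, h₂, ?_⟩
    rcases h₄ with h | h | h
    · exact Or.inl h.symm
    · exact Or.inr (Or.inr h)
    · exact Or.inr (Or.inl h)⟩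
  loopless := ⟨fun _ h => h.1 rfl⟩

theorem isolate_adj {G : SimpleGraph V} {x a b : V} :
    (G.isolate x).Adj a b ↔ G.Adj a b ∧ a ≠ x ∧ b ≠ x := Iff.rfl

theorem mergeInto_adj {G : SimpleGraph V} {x y a b : V} :
    (G.mergeInto x y).Adj a b ↔ a ≠ b ∧ a ≠ x ∧ b ≠ x ∧
      (G.Adj a b ∨ (a = y ∧ G.Adj x b) ∨ (b = y ∧ G.Adj x a)) := Iff.rfl

theorem isolate_le (G : SimpleGraph V) (x : V) : G.isolate x ≤ G := fun _ _ h => h.1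

theorem HasMinor.mono {W : Type*} {G G' : SimpleGraph V} {H : SimpleGraph W} (hle : G ≤ G')
    (h : G.HasMinor H) : G'.HasMinor H := by
  obtain ⟨f, hconn, hdisj, hadj⟩ := h
  refine ⟨f, fun w => (hconn w).mono fun a b hab => hle hab, hdisj, fun w₁ w₂ hw => ?_⟩
  obtain ⟨a, ha, b, hb, hab⟩ := hadj hw
  exact ⟨a, ha, b, hb, hle hab⟩

theorem HasMinor.of_mergeInto {W : Type*} {G : SimpleGraph V} {H : SimpleGraph W} {x y : V}
    (hxy : G.Adj x y) (hH : ∀ w, ∃ w', H.Adj w w') (h : (G.mergeInto x y).HasMinor H) :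
    G.HasMinor H := by
  classical
  obtain ⟨f, hconn, hdisj, hadj⟩ := h
  let φ : V → V := fun a => if a = x then y else a
  have hφx : φ x = y := if_pos rfl
  have hφ : ∀ {a}, a ≠ x → φ a = a := fun h => if_neg h
  have hφne : ∀ a, φ a ≠ x := fun a => by
    by_cases ha : a = x
    · rw [ha, hφx]; exact hxy.ne'
    · rwa [hφ ha]
  refine ⟨fun w => φ ⁻¹' f w, fun w => ?_, fun w₁ w₂ hw => (hdisj hw).preimage φ,
    fun w₁ w₂ hw => ?_⟩
  · have hlift : ∀ a b : f w, ((G.mergeInto x y).induce (f w)).Reachable a b →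
        ∀ (ha : φ a ∈ f w) (hb : φ b ∈ f w),
          (G.induce (φ ⁻¹' f w)).Reachable ⟨a, ha⟩ ⟨b, hb⟩ := by
      rintro a b ⟨p⟩
      induction p with
      | nil => intro _ _; exact Reachable.refl _
      | @cons a c b hac p ih =>
        intro ha hb
        obtain ⟨-, hax, hcx, hor⟩ : (G.mergeInto x y).Adj a c := hac
        have hc : φ c ∈ f w := by rw [hφ hcx]; exact c.2
        refine Reachable.trans ?_ (ih hc hb)
        rcases hor with h | ⟨hy, h⟩ | ⟨hy, h⟩
        · exact Adj.reachable (G := G.induce (φ ⁻¹' f w)) h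
        · have hx : φ x ∈ f w := by rw [hφx, ← hy]; exact a.2
          have h₁ : (G.induce (φ ⁻¹' f w)).Adj ⟨a, ha⟩ ⟨x, hx⟩ := by
            change G.Adj a x
            rw [hy]; exact hxy.symm
          have h₂ : (G.induce (φ ⁻¹' f w)).Adj ⟨x, hx⟩ ⟨c, hc⟩ := h
          exact h₁.reachable.trans h₂.reachable
        · have hx : φ x ∈ f w := by rw [hφx, ← hy]; exact c.2
          have h₁ : (G.induce (φ ⁻¹' f w)).Adj ⟨a, ha⟩ ⟨x, hx⟩ := h.symm
          have h₂ : (G.induce (φ ⁻¹' f w)).Adj ⟨x, hx⟩ ⟨c, hc⟩ := by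
            change G.Adj x c
            rw [hy]; exact hxy
          exact h₁.reachable.trans h₂.reachable
    have hrep : ∀ a (ha : φ a ∈ f w), ∃ ha' : φ (φ a) ∈ f w,
        (G.induce (φ ⁻¹' f w)).Reachable ⟨a, ha⟩ ⟨φ a, ha'⟩ := by
      intro a ha
      refine ⟨by rwa [hφ (hφne a)], ?_⟩
      by_cases hax : a = x
      · refine Adj.reachable (G := G.induce (φ ⁻¹' f w)) ?_
        change G.Adj a (φ a)
        rw [hax, hφx]; exact hxy
      · have : (⟨a, ha⟩ : φ ⁻¹' f w) = ⟨φ a, by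
            change φ (φ a) ∈ f w
            rwa [hφ (hφne a)]⟩ := Subtype.ext (hφ hax).symm
        rw [← this]
    obtain ⟨w', hw'⟩ := hH w
    obtain ⟨a, ha, b, -, hab⟩ := hadj hw'
    have : Nonempty (φ ⁻¹' f w) := ⟨⟨a, by
      change φ a ∈ f w
      rwa [hφ hab.2.1]⟩⟩
    refine Connected.mk ?_
    rintro ⟨p, hp⟩ ⟨q, hq⟩
    obtain ⟨hp', hpr⟩ := hrep p hp
    obtain ⟨hq', hqr⟩ := hrep q hq
    exact (hpr.trans (hlift ⟨φ p, hp⟩ ⟨φ q, hq⟩ ((hconn w).preconnected _ _) hp' hq')).trans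
      hqr.symm
  · obtain ⟨a, ha, b, hb, -, hax, hbx, hor⟩ := hadj hw
    have ha' : φ a ∈ f w₁ := by rwa [hφ hax]
    have hb' : φ b ∈ f w₂ := by rwa [hφ hbx]
    rcases hor with h | ⟨rfl, h⟩ | ⟨rfl, h⟩
    · exact ⟨a, ha', b, hb', h⟩
    · exact ⟨x, by change φ x ∈ f w₁; rwa [hφx], b, hb', h⟩
    · exact ⟨a, ha', x, by change φ x ∈ f w₂; rwa [hφx], h.symm⟩

/-- `G` has no `K₄` minor. -/
def K4MinorFree (G : SimpleGraph V) : Prop := ¬ G.HasMinor (completeGraph (Fin 4))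

theorem K4MinorFree.anti {G G' : SimpleGraph V} (h : G'.K4MinorFree) (hle : G ≤ G') :
    G.K4MinorFree := fun hG => h (hG.mono hle)

theorem K4MinorFree.mergeInto {G : SimpleGraph V} (h : G.K4MinorFree) {x y : V}
    (hxy : G.Adj x y) : (G.mergeInto x y).K4MinorFree := fun hG =>
  h (hG.of_mergeInto hxy fun w => ⟨w + 1, by
    change w ≠ w + 1
    fin_cases w <;> decide⟩)

theorem K4MinorFree.not_clique {G : SimpleGraph V} (h : G.K4MinorFree) {a b c d : V}
    (hab : G.Adj a b) (hac : G.Adj a c) (had : G.Adj a d) (hbc : G.Adj b c) (hbd : G.Adj b d) :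
    ¬ G.Adj c d := by
  intro hcd
  have key : ∀ i j : Fin 4, i ≠ j → G.Adj (![a, b, c, d] i) (![a, b, c, d] j) := by
    intro i j hij
    fin_cases i <;> fin_cases j <;> first | exact absurd rfl hij | simp [*, G.adj_comm]
  refine h ⟨fun i => {![a, b, c, d] i}, fun i => ?_, fun i j hij => ?_, fun i j hij => ?_⟩
  · exact Connected.of_subsingleton
  · exact Set.disjoint_singleton.2 (key i j hij).ne
  · exact ⟨_, rfl, _, rfl, key i j hij⟩

/-- The vertex `w` has degree one or two in `G`. -/
def IsLow (G : SimpleGraph V) (w : V) : Prop :=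
  ∃ p q, G.Adj w p ∧ ∀ z, G.Adj w z → z = p ∨ z = q

theorem exists_adj_ne_ne_of_not_isLow {G : SimpleGraph V} {a b : V} (h : ¬ G.IsLow a)
    (hab : G.Adj a b) (c : V) : ∃ z, G.Adj a z ∧ z ≠ b ∧ z ≠ c := by
  by_contra! hno
  exact h ⟨b, c, hab, fun z hz => or_iff_not_imp_left.2 (hno z hz)⟩

theorem support_isolate_ssubset {G : SimpleGraph V} {x y : V} (hxy : G.Adj x y) :
    (G.isolate x).support ⊂ G.support := by
  refine Set.ssubset_iff_exists.2 ⟨?_, x, ⟨y, hxy⟩, ?_⟩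
  · rintro a ⟨b, hab⟩
    exact ⟨b, hab.1⟩
  · rintro ⟨b, hb⟩
    exact hb.2.1 rfl

theorem support_mergeInto_ssubset {G : SimpleGraph V} {x y : V} (hxy : G.Adj x y) :
    (G.mergeInto x y).support ⊂ G.support := by
  refine Set.ssubset_iff_exists.2 ⟨?_, x, ⟨y, hxy⟩, ?_⟩
  · rintro a ⟨b, -, -, -, h | ⟨rfl, h⟩ | ⟨rfl, h⟩⟩
    · exact ⟨b, h⟩
    · exact ⟨x, hxy.symm⟩
    · exact ⟨x, h.symm⟩
  · rintro ⟨b, hb⟩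
    exact hb.2.1 rfl

theorem exists_isLow_ne_of_forall_edge {G : SimpleGraph V}
    (hG : ∀ s t w, G.Adj s t → w ≠ s → w ≠ t → w ∈ G.support →
      ∃ x, x ≠ s ∧ x ≠ t ∧ G.IsLow x) (v : V) {p q : V} (hpq : G.Adj p q) :
    ∃ w, w ≠ v ∧ G.IsLow w := by
  by_contra! hno
  have third : ∀ {a b}, a ≠ v → G.Adj a b → ∃ z, G.Adj a z ∧ z ≠ b := fun {a b} ha hab =>
    (exists_adj_ne_ne_of_not_isLow (hno a ha) hab b).imp fun _ h => ⟨h.1, h.2.1⟩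
  by_cases hv : ∃ t, G.Adj v t
  · obtain ⟨t, hvt⟩ := hv
    obtain ⟨z, htz, hzv⟩ := third hvt.ne' hvt.symm
    obtain ⟨x, hx, -, hlow⟩ := hG v t z hvt hzv htz.ne' ⟨t, htz.symm⟩
    exact hno x hx hlow
  · have hpv : p ≠ v := by rintro rfl; exact hv ⟨q, hpq⟩
    obtain ⟨z, hpz, hzq⟩ := third hpv hpq
    obtain ⟨x, -, -, hlow⟩ := hG p q z hpq hpz.ne' hzq ⟨p, hpz.symm⟩
    refine hno x ?_ hlow
    rintro rfl
    obtain ⟨r, -, hr, -⟩ := hlow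
    exact hv ⟨r, hr⟩

theorem exists_coloring_update_isLow {G : SimpleGraph V} {w : V} (hw : G.IsLow w)
    (κ : (G.isolate w).Coloring (Fin 3)) :
    ∃ c : G.Coloring (Fin 3), ∀ a, a ≠ w → c a = κ a := by
  classical
  obtain ⟨p, q, -, hN⟩ := hw
  obtain ⟨k, hkp, hkq⟩ : ∃ k : Fin 3, k ≠ κ p ∧ k ≠ κ q := by
    generalize κ p = i
    generalize κ q = j
    revert i j
    decide
  refine ⟨Coloring.mk (fun a => if a = w then k else κ a) ?_, fun a ha => if_neg ha⟩
  intro a b hab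
  have hval : ∀ {a b}, G.Adj a b → a ≠ w → b ≠ w → κ a ≠ κ b := fun h ha hb =>
    κ.valid (isolate_adj.2 ⟨h, ha, hb⟩)
  have := hval hab
  have := hN a
  have := hN b
  have := hab.symm
  have := hab.ne
  grind

/-- Two distinct adjacent vertices have at most one common neighbor. -/
def DiamondFree (G : SimpleGraph V) : Prop :=
  ∀ ⦃a b x y⦄, x ≠ y → G.Adj a b → G.Adj x a → G.Adj x b → G.Adj y a → ¬ G.Adj y b

theorem DiamondFree.anti {G G' : SimpleGraph V} (h : G'.DiamondFree) (hle : G ≤ G') :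
    G.DiamondFree := fun _ _ _ _ hxy h₁ h₂ h₃ h₄ h₅ =>
  h hxy (hle h₁) (hle h₂) (hle h₃) (hle h₄) (hle h₅)

variable [Finite V]

theorem K4MinorFree.exists_isLow_avoiding_edge {G : SimpleGraph V} (hG : G.K4MinorFree)
    (s t w : V) (hst : G.Adj s t) (hws : w ≠ s) (hwt : w ≠ t) (hw : w ∈ G.support) :
    ∃ x, x ≠ s ∧ x ≠ t ∧ G.IsLow x := by
  induction hn : G.support.ncard using Nat.strong_induction_on generalizing G s t w with
  | _ n ih =>
  subst hn
  classical
  by_contra! hno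
  have third : ∀ a, a ≠ s → a ≠ t → ∀ b c, G.Adj a b → ∃ z, G.Adj a z ∧ z ≠ b ∧ z ≠ c :=
    fun a ha hat _ c hab => exists_adj_ne_ne_of_not_isLow (hno a ha hat) hab c
  obtain ⟨r, hwr : G.Adj w r⟩ := hw
  by_cases hx : ∃ x z, G.Adj x s ∧ G.Adj x t ∧ G.Adj x z ∧ z ≠ s ∧ z ≠ t ∧
      ∀ y, G.Adj x y → y = s ∨ y = t ∨ y = z
  · obtain ⟨x, z, hxs, hxt, hxz, hzs, hzt, hN⟩ := hx
    have hnot : ¬ (G.Adj z s ∧ G.Adj z t) := fun h =>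
      hG.not_clique hxs hxt hxz hst h.1.symm h.2.symm
    obtain ⟨y, hys, hyt, p, q, hyp, hyN⟩ := ih _ (Set.ncard_lt_ncard
      (support_mergeInto_ssubset hxz)) (hG.mergeInto hxz) s t z
      (by rw [mergeInto_adj]; exact ⟨hst.ne, hxs.ne', hxt.ne', Or.inl hst⟩) hzs hzt
      ⟨s, by exact ⟨hzs, hxz.ne', hxs.ne', Or.inr (Or.inl ⟨rfl, hxs⟩)⟩⟩ rfl
    simp only [mergeInto_adj] at hyp hyN
    by_cases hyz : y = z
    · subst hyz
      obtain ⟨z₁, h₁, h₁x, h₁s⟩ := third y hys hyt x s hxz.symm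
      obtain ⟨z₂, h₂, h₂x, h₂t⟩ := third y hys hyt x t hxz.symm
      have e₁ := hyN s ⟨hys, hxz.ne', hxs.ne', Or.inr (Or.inl ⟨rfl, hxs⟩)⟩
      have e₂ := hyN t ⟨hyt, hxz.ne', hxt.ne', Or.inr (Or.inl ⟨rfl, hxt⟩)⟩
      have e₃ := hyN z₁ ⟨h₁.ne, hxz.ne', h₁x, Or.inl h₁⟩
      have e₄ := hyN z₂ ⟨h₂.ne, hxz.ne', h₂x, Or.inl h₂⟩
      have := hst.ne
      grind
    · have hxy : ¬ G.Adj x y := fun h => by grind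
      have hyx : ¬ G.Adj y x := fun h => hxy h.symm
      refine hno y hys hyt ⟨p, q, by grind, fun a ha => hyN a ⟨ha.ne, hyp.2.1, ?_, Or.inl ha⟩⟩
      rintro rfl
      exact hyx ha
  · have hlow := exists_isLow_ne_of_forall_edge (G := G.mergeInto t s)
      (fun s' t' w' h₁ h₂ h₃ h₄ => ih _ (Set.ncard_lt_ncard
        (support_mergeInto_ssubset hst.symm)) (hG.mergeInto hst.symm) s' t' w' h₁ h₂ h₃ h₄ rfl) s
      (p := w) (q := if r = t then s else r) (by
        rw [mergeInto_adj]
        have := hwr.ne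
        have := hst.ne
        have := hwr.symm
        grind)
    obtain ⟨y, hys, p, q, hyp, hyN⟩ := hlow
    simp only [mergeInto_adj] at hyp hyN
    have hyt := hyp.2.1
    have hN : ∀ a, G.Adj y a → a ≠ t → a = p ∨ a = q := fun a ha hat =>
      hyN a ⟨ha.ne, hyt, hat, Or.inl ha⟩
    by_cases hyt' : G.Adj y t
    · have es := hyN s ⟨hys, hyt, hst.ne, Or.inr (Or.inr ⟨rfl, hyt'.symm⟩)⟩
      by_cases hys' : G.Adj y s
      · obtain ⟨z, hyz, hzs, hzt⟩ := third y hys hyt s t hys'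
        refine hx ⟨y, z, hys', hyt', hyz, hzs, hzt, fun a ha => ?_⟩
        have := hN z hyz hzt
        have := hN a ha
        grind
      · obtain ⟨z, hyz, hzt, hzo⟩ := third y hys hyt t (if p = s then q else p) hyt'
        have := hN z hyz hzt
        grind
    · refine hno y hys hyt ⟨p, q, ?_, fun a ha => hN a ha fun h => hyt' (h ▸ ha)⟩
      have : ¬ G.Adj t y := fun h => hyt' h.symm
      grind

theorem K4MinorFree.exists_isLow_ne {G : SimpleGraph V} (hG : G.K4MinorFree) (v : V) {p q : V}
    (hpq : G.Adj p q) : ∃ w, w ≠ v ∧ G.IsLow w :=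
  exists_isLow_ne_of_forall_edge hG.exists_isLow_avoiding_edge v hpq

theorem K4MinorFree.nonempty_coloring {G : SimpleGraph V} (hG : G.K4MinorFree) :
    Nonempty (G.Coloring (Fin 3)) := by
  induction hn : G.support.ncard using Nat.strong_induction_on generalizing G with
  | _ n ih =>
  subst hn
  by_cases he : ∃ p q, G.Adj p q
  · obtain ⟨p, q, hpq⟩ := he
    obtain ⟨w, -, hw⟩ := hG.exists_isLow_ne p hpq
    have hw' := hw
    obtain ⟨r, -, hwr, -⟩ := hw'
    obtain ⟨κ⟩ := ih _ (Set.ncard_lt_ncard (support_isolate_ssubset hwr))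
      (hG.anti (G.isolate_le w)) rfl
    obtain ⟨c, -⟩ := exists_coloring_update_isLow hw κ
    exact ⟨c⟩
  · exact ⟨Coloring.mk (fun _ => 0) fun {a b} hab => absurd ⟨a, b, hab⟩ he⟩

theorem K4MinorFree.exists_coloring_apply_eq {G : SimpleGraph V} (hG : G.K4MinorFree) (v : V)
    (k : Fin 3) : ∃ c : G.Coloring (Fin 3), c v = k := by
  obtain ⟨c⟩ := hG.nonempty_coloring
  exact ⟨Coloring.mk (fun a => Equiv.swap (c v) k (c a)) fun {a b} hab h =>
    c.valid hab ((Equiv.swap (c v) k).injective h), Equiv.swap_apply_left _ _⟩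

theorem K4MinorFree.exists_coloring_apply_eq_apply_eq {G : SimpleGraph V} (hG : G.K4MinorFree)
    {a v : V} (hav : G.Adj a v) {i k : Fin 3} (hik : i ≠ k) :
    ∃ c : G.Coloring (Fin 3), c a = i ∧ c v = k := by
  obtain ⟨c, hc⟩ := hG.exists_coloring_apply_eq v k
  refine ⟨Coloring.mk (fun x => Equiv.swap (c a) i (c x)) fun {a b} hab h =>
    c.valid hab ((Equiv.swap _ i).injective h), Equiv.swap_apply_left _ _, ?_⟩
  have := c.valid hav
  change Equiv.swap (c a) i (c v) = k
  rw [hc] at this ⊢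
  exact Equiv.swap_apply_of_ne_of_ne this.symm hik.symm

theorem K4MinorFree.adj_of_neighbors_eq_pair {G : SimpleGraph V} (hG : G.K4MinorFree)
    {u v a b : V} (hlow : ∀ w, w ≠ u → w ≠ v → ¬ G.IsLow w) (huv : ¬ G.Adj u v)
    (hua : G.Adj u a) (hub : G.Adj u b) (hab : a ≠ b) (hu : ∀ z, G.Adj u z → z = a ∨ z = b) :
    G.Adj a b := by
  classical
  by_contra hnab
  have hva : a ≠ v := fun h => huv (h ▸ hua)
  have hvb : b ≠ v := fun h => huv (h ▸ hub)
  obtain ⟨w, hwv, p, q, hwp, hwN⟩ := (hG.mergeInto hua).exists_isLow_ne v (p := a) (q := b)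
    ⟨hab, hua.ne', hub.ne', Or.inr (Or.inl ⟨rfl, hub⟩)⟩
  have hwu := hwp.2.1
  have hN : ∀ z, G.Adj w z → z ≠ u → z = p ∨ z = q := fun z hz hzu =>
    hwN z ⟨hz.ne, hwu, hzu, Or.inl hz⟩
  have hw := hlow w hwu hwv
  by_cases hwa : w = a
  · subst hwa
    have hb := hwN b ⟨hab, hwu, hub.ne', Or.inr (Or.inl ⟨rfl, hub⟩)⟩
    obtain ⟨z, hz, hzu, hzo⟩ := exists_adj_ne_ne_of_not_isLow hw hua.symm
      (if p = b then q else p)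
    have := hN z hz hzu
    grind
  by_cases hwb : w = b
  · subst hwb
    have ha := hwN a ⟨hab.symm, hwu, hua.ne', Or.inr (Or.inr ⟨rfl, hub⟩)⟩
    obtain ⟨z, hz, hzu, hzo⟩ := exists_adj_ne_ne_of_not_isLow hw hub.symm
      (if p = a then q else p)
    have := hN z hz hzu
    have := hz.symm
    grind
  · have hwu' : ¬ G.Adj u w := fun h => by grind
    refine hw ⟨p, q, ?_, fun z hz => hN z hz ?_⟩
    · have := mergeInto_adj.1 hwp
      grind
    · rintro rfl
      exact hwu' hz.symm

theorem K4MinorFree.exists_opposite_edge {G : SimpleGraph V} (hG : G.K4MinorFree)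
    (hD : G.DiamondFree) {u v a b a' : V} (hlow : ∀ w, w ≠ u → w ≠ v → ¬ G.IsLow w)
    (huv : ¬ G.Adj u v) (hua : G.Adj u a) (hub : G.Adj u b) (hab : G.Adj a b)
    (hu : ∀ z, G.Adj u z → z = a ∨ z = b) (haa' : G.Adj a a') (hua' : a' ≠ u) (hba' : a' ≠ b)
    (ha : ∀ z, G.Adj a z → z = u ∨ z = b ∨ z = a') :
    ∃ b', b' ≠ u ∧ b' ≠ a ∧ G.Adj a' b' ∧ ∀ z, G.Adj b z → z = u ∨ z = a ∨ z = b' := by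
  have hva : a ≠ v := fun h => huv (h ▸ hua)
  have hvb : b ≠ v := fun h => huv (h ▸ hub)
  have hna'b : ¬ G.Adj a' b := hD hua'.symm hab hua hub haa'.symm
  have hna'u : ¬ G.Adj u a' := fun h => by
    have := haa'.ne
    grind
  have hfar : ∀ {w}, w ≠ a → w ≠ b → ¬ G.Adj w u := fun h₁ h₂ h =>
    (hu _ h.symm).elim h₁ h₂
  have hfar' : ∀ {w}, w ≠ u → w ≠ b → w ≠ a' → ¬ G.Adj w a := fun h₁ h₂ h₃ h => by
    have := ha _ h.symm
    grind
  have habD : (G.isolate u).Adj a b := ⟨hab, hua.ne', hub.ne'⟩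
  have hG₁ := (hG.anti (G.isolate_le u)).mergeInto habD
  have hba'D : ((G.isolate u).mergeInto a b).Adj b a' :=
    ⟨hba'.symm, hab.ne', haa'.ne', Or.inr (Or.inl ⟨rfl, haa', hua.ne', hua'⟩)⟩
  obtain ⟨b', hbb', hbu, hba, hb⟩ : ∃ b', G.Adj b b' ∧ b' ≠ u ∧ b' ≠ a ∧
      ∀ z, G.Adj b z → z = u ∨ z = a ∨ z = b' := by
    classical
    obtain ⟨w, hwv, p, q, hwp, hwN⟩ := hG₁.exists_isLow_ne v hba'D
    have hwa := hwp.2.1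
    have hwu : w ≠ u := by
      have := mergeInto_adj.1 hwp
      simp only [isolate_adj] at this
      have := hub.ne'
      grind
    have hw := hlow w hwu hwv
    have hN : ∀ z, G.Adj w z → z ≠ u → z ≠ a → z = p ∨ z = q := fun z hz hzu hza =>
      hwN z ⟨hz.ne, hwa, hza, Or.inl ⟨hz, hwu, hzu⟩⟩
    by_cases hwb : w = b
    · subst hwb
      obtain ⟨b', hbb', hbu, hba⟩ := exists_adj_ne_ne_of_not_isLow hw hub.symm a
      refine ⟨b', hbb', hbu, hba, fun z hz => ?_⟩
      have := hwN a' hba'D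
      have := hN b' hbb' hbu hba
      have := hN z hz
      have := hz.symm
      have := hbb'.symm
      grind
    by_cases hwa' : w = a'
    · subst hwa'
      have := hwN b hba'D.symm
      obtain ⟨z, hz, hza, hzo⟩ := exists_adj_ne_ne_of_not_isLow hw haa'.symm
        (if p = b then q else p)
      have := hN z hz (fun h => hna'u (h ▸ hz.symm)) hza
      grind
    · refine absurd ⟨p, q, ?_, fun z hz => hN z hz ?_ ?_⟩ hw
      · have := mergeInto_adj.1 hwp
        simp only [isolate_adj] at this
        have := hfar' hwu hwb hwa'
        have := G.adj_comm a w
        grind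
      · rintro rfl
        exact hfar hwa hwb hz
      · rintro rfl
        exact hfar' hwu hwb hwa' hz
  refine ⟨b', hbu, hba, ?_, hb⟩
  by_contra hna'b'
  have hne : a' ≠ b' := by
    rintro rfl
    exact hna'b hbb'.symm
  have hbb'D : ((G.isolate u).mergeInto a b).Adj b b' :=
    ⟨hbb'.ne, hab.ne', hba, Or.inl ⟨hbb', hub.ne', hbu⟩⟩
  have ha'b'D : (((G.isolate u).mergeInto a b).mergeInto b a').Adj a' b' :=
    ⟨hne, hba', hbb'.ne', Or.inr (Or.inl ⟨rfl, hbb'D⟩)⟩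
  classical
  obtain ⟨w, hwv, p, q, hwp, hwN⟩ := (hG₁.mergeInto hba'D).exists_isLow_ne v ha'b'D
  simp only [mergeInto_adj, isolate_adj] at hwp
  have hwb := hwp.2.1
  have hwa : w ≠ a := by
    have := haa'.ne
    grind
  have hwu : w ≠ u := by
    have := hub.ne
    grind
  have hw := hlow w hwu hwv
  have hN : ∀ z, G.Adj w z → z ≠ u → z ≠ a → z ≠ b → z = p ∨ z = q := fun z hz hzu hza hzb =>
    hwN z ⟨hz.ne, hwb, hzb, Or.inl ⟨hz.ne, hwa, hza, Or.inl ⟨hz, hwu, hzu⟩⟩⟩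
  have hwu' := hfar hwa hwb
  by_cases hwa' : w = a'
  · subst hwa'
    have := hwN b' ha'b'D
    obtain ⟨z, hz, hza, hzo⟩ := exists_adj_ne_ne_of_not_isLow hw haa'.symm
      (if p = b' then q else p)
    have : z ≠ b' := fun h => hna'b' (h ▸ hz)
    have := hN z hz (fun h => hwu' (h ▸ hz)) hza (fun h => hna'b (h ▸ hz))
    grind
  by_cases hwb' : w = b'
  · subst hwb'
    have := hwN a' ha'b'D.symm
    obtain ⟨z, hz, hzb, hzo⟩ := exists_adj_ne_ne_of_not_isLow hw hbb'.symm
      (if p = a' then q else p)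
    have : z ≠ a' := fun h => hna'b' (h ▸ hz.symm)
    have := hN z hz (fun h => hwu' (h ▸ hz)) (fun h => hfar' hwu hwb hwa' (h ▸ hz)) hzb
    grind
  · have hwa'' := hfar' hwu hwb hwa'
    have hwb'' : ¬ G.Adj w b := fun h => by
      have := hb _ h.symm
      grind
    have := G.adj_comm a w
    have := G.adj_comm b w
    refine hw ⟨p, q, ?_, fun z hz => hN z hz ?_ ?_ ?_⟩ <;> grind

theorem K4MinorFree.exists_opposite_edge_of_neighbors_eq_pair {G : SimpleGraph V}
    (hG : G.K4MinorFree) (hD : G.DiamondFree) {u v a b : V}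
    (hlow : ∀ w, w ≠ u → w ≠ v → ¬ G.IsLow w) (huv : ¬ G.Adj u v)
    (hua : G.Adj u a) (hub : G.Adj u b) (hab : G.Adj a b)
    (hu : ∀ z, G.Adj u z → z = a ∨ z = b) :
    ∃ a' b', G.Adj a' b' ∧ a' ≠ u ∧ b' ≠ u ∧ a' ≠ b ∧ b' ≠ a ∧
      (∀ z, G.Adj a z → z = u ∨ z = b ∨ z = a') ∧ ∀ z, G.Adj b z → z = u ∨ z = a ∨ z = b' := by
  have hva : a ≠ v := fun h => huv (h ▸ hua)
  have hvb : b ≠ v := fun h => huv (h ▸ hub)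
  have main : ∀ {a b}, G.Adj u a → G.Adj u b → G.Adj a b → (∀ z, G.Adj u z → z = a ∨ z = b) →
      a ≠ v → ∀ p q, (∀ z, (G.isolate u).Adj a z → z = p ∨ z = q) →
      ∃ a' b', G.Adj a' b' ∧ a' ≠ u ∧ b' ≠ u ∧ a' ≠ b ∧ b' ≠ a ∧
      (∀ z, G.Adj a z → z = u ∨ z = b ∨ z = a') ∧ ∀ z, G.Adj b z → z = u ∨ z = a ∨ z = b' := by
    intro a b hua hub hab hu hav p q hN
    obtain ⟨a', haa', hua', hba'⟩ :=
      exists_adj_ne_ne_of_not_isLow (hlow a hua.ne' hav) hua.symm b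
    have ha : ∀ z, G.Adj a z → z = u ∨ z = b ∨ z = a' := fun z hz => by
      have h₁ := hN b ⟨hab, hua.ne', hub.ne'⟩
      have h₂ := hN a' ⟨haa', hua.ne', hua'⟩
      have h₃ : z ≠ u → z = p ∨ z = q := fun h => hN z ⟨hz, hua.ne', h⟩
      grind
    obtain ⟨b', hb'u, hb'a, ha'b', hb⟩ :=
      hG.exists_opposite_edge hD hlow huv hua hub hab hu haa' hua' hba' ha
    exact ⟨a', b', ha'b', hua', hb'u, hba', hb'a, ha, hb⟩
  obtain ⟨w, hwv, p, q, ⟨hwp, hwu, hpu⟩, hwN⟩ :=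
    (hG.anti (G.isolate_le u)).exists_isLow_ne v (p := a) (q := b) ⟨hab, hua.ne', hub.ne'⟩
  by_cases hwa : w = a
  · subst hwa
    exact main hua hub hab hu hva p q hwN
  by_cases hwb : w = b
  · subst hwb
    obtain ⟨a', b', h₁, h₂, h₃, h₄, h₅, h₆, h₇⟩ :=
      main hub hua hab.symm (fun z hz => (hu z hz).symm) hvb p q hwN
    exact ⟨b', a', h₁.symm, h₃, h₂, h₅, h₄, h₇, h₆⟩
  · refine absurd ⟨p, q, hwp, fun z hz => hwN z ⟨hz, hwu, ?_⟩⟩ (hlow w hwu hwv)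
    rintro rfl
    exact (hu w hz.symm).elim hwa hwb

theorem K4MinorFree.exists_coloring_of_not_adj {G : SimpleGraph V} (hG : G.K4MinorFree)
    (hD : G.DiamondFree) {u v : V} (huv : u ≠ v) (hadj : ¬ G.Adj u v) (c₁ c₂ : Fin 3) :
    ∃ c : G.Coloring (Fin 3), c u = c₁ ∧ c v = c₂ := by
  classical
  induction hn : G.support.ncard using Nat.strong_induction_on generalizing G u v c₁ c₂ with
  | _ n ih =>
  subst hn
  by_cases hlow : ∃ w, w ≠ u ∧ w ≠ v ∧ G.IsLow w
  · obtain ⟨w, hwu, hwv, hw⟩ := hlow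
    obtain ⟨r, -, hwr, -⟩ := id hw
    obtain ⟨κ, hκu, hκv⟩ := ih _ (Set.ncard_lt_ncard (support_isolate_ssubset hwr))
      (hG.anti (G.isolate_le w)) (hD.anti (G.isolate_le w)) huv (fun h => hadj h.1) c₁ c₂ rfl
    obtain ⟨c, hc⟩ := exists_coloring_update_isLow hw κ
    exact ⟨c, (hc u hwu.symm).trans hκu, (hc v hwv.symm).trans hκv⟩
  push Not at hlow
  by_cases he : ∃ p q, G.Adj p q
  swap
  · exact ⟨Coloring.mk (fun x => if x = u then c₁ else c₂) fun {a b} hab => absurd ⟨a, b, hab⟩ he,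
      if_pos rfl, if_neg huv.symm⟩
  obtain ⟨p, q, hpq⟩ := he
  obtain ⟨w, hwv, a, b, hua, hu⟩ := hG.exists_isLow_ne v hpq
  obtain rfl : w = u := by
    by_contra hwu
    exact hlow w hwu hwv ⟨a, b, hua, hu⟩
  have hav : a ≠ v := fun h => hadj (h ▸ hua)
  by_cases hub : G.Adj w b ∧ a ≠ b
  · obtain ⟨hub, hab⟩ := hub
    have hbv : b ≠ v := fun h => hadj (h ▸ hub)
    have hab := hG.adj_of_neighbors_eq_pair hlow hadj hua hub hab hu
    obtain ⟨a', b', ha'b', ha'u, hb'u, ha'b, hb'a, ha, hb⟩ :=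
      hG.exists_opposite_edge_of_neighbors_eq_pair hD hlow hadj hua hub hab hu
    obtain ⟨κ, hκ⟩ := hG.exists_coloring_apply_eq v c₂
    obtain ⟨i, j, hia, hjb, hij, hi, hj⟩ : ∃ i j : Fin 3, i ≠ κ a' ∧ j ≠ κ b' ∧ i ≠ j ∧
        i ≠ c₁ ∧ j ≠ c₁ := by
      have := κ.valid ha'b'
      generalize κ a' = x at *
      generalize κ b' = y at *
      clear hκ
      revert x y c₁
      decide
    refine ⟨Coloring.mk (fun x => if x = w then c₁ else if x = a then i else if x = b then j
      else κ x) ?_, if_pos rfl, ?_⟩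
    · intro x y hxy
      have := κ.valid hxy
      have := hxy.ne
      have := hxy.symm
      grind
    · change (if v = w then c₁ else if v = a then i else if v = b then j else κ v) = c₂
      grind
  · have hu' : ∀ z, G.Adj w z → z = a := fun z hz => by grind
    obtain ⟨κ, hκa, hκv⟩ : ∃ κ : (G.isolate w).Coloring (Fin 3), κ a ≠ c₁ ∧ κ v = c₂ := by
      obtain ⟨i, hi₁, hi₂⟩ : ∃ i : Fin 3, i ≠ c₁ ∧ i ≠ c₂ := by
        revert c₁ c₂
        decide
      by_cases hav' : (G.isolate w).Adj a v
      · obtain ⟨κ, h₁, h₂⟩ :=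
          (hG.anti (G.isolate_le w)).exists_coloring_apply_eq_apply_eq hav' hi₂
        exact ⟨κ, h₁ ▸ hi₁, h₂⟩
      · obtain ⟨κ, h₁, h₂⟩ := ih _ (Set.ncard_lt_ncard (support_isolate_ssubset hua))
          (hG.anti (G.isolate_le w)) (hD.anti (G.isolate_le w)) hav hav' i c₂ rfl
        exact ⟨κ, h₁ ▸ hi₁, h₂⟩
    refine ⟨Coloring.mk (fun x => if x = w then c₁ else κ x) ?_, if_pos rfl,
      (if_neg huv.symm).trans hκv⟩
    intro x y hxy
    have hval : x ≠ w → y ≠ w → κ x ≠ κ y := fun hx hy => κ.valid ⟨hxy, hx, hy⟩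
    have := hxy.ne
    have := hxy.symm
    grind

end SimpleGraph

theorem diamondFree_of_not_isDiamondCopy {V : Type*} {G : SimpleGraph V}
    (h : ¬ ∃ f : Fin 4 → V, IsDiamondCopy G f) : G.DiamondFree := by
  intro a b x y hxy hab hxa hxb hya hyb
  refine h ⟨![x, y, a, b], ?_, ?_⟩
  · have := hab.ne
    have := hxa.ne
    have := hxb.ne
    have := hya.ne
    have := hyb.ne
    intro i j hij
    fin_cases i <;> fin_cases j <;> simp_all [eq_comm]
  · intro i j hij
    fin_cases i <;> fin_cases j <;>
      simp_all [diamondGraph, G.adj_comm]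

theorem precoloring_two_independent_two_triangles_no_diamond_twoConnected
    {V : Type*} [Fintype V] (G : SimpleGraph V)
    (hout : G.Outerplanar) (h2c : G.TwoConnected)
    (htri : {t : Finset V | G.IsNClique 3 t}.ncard = 2)
    (hnodiamond : ¬ ∃ f : Fin 4 → V, IsDiamondCopy G f)
    (u v : V) (huv : u ≠ v) (hadj : ¬ G.Adj u v)
    (c₁ c₂ : Fin 3) :
    ∃ c : G.Coloring (Fin 3), c u = c₁ ∧ c v = c₂ := by
  exact SimpleGraph.K4MinorFree.exists_coloring_of_not_adj hout.1
    (diamondFree_of_not_isDiamondCopy hnodiamond) huv hadj c₁ c₂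
end

section
/- Let G be a finite simple 2-connected outerplanar graph containing exactly two triangles, which contains a diamond D (a subgraph isomorphic to K₄ minus one edge), and let u, v be the two diamond vertices of D (the two nonadjacent vertices of D). Then every assignment of the same color from a 3-element color set to both u and v extends to a proper 3-coloring of G. -/
namespace SimpleGraph

variable {V : Type*} {G : SimpleGraph V}

/-- `p 0, …, p n` is a path of `G` with all its vertices in `s`. -/
structure IsPathIn (G : SimpleGraph V) (s : Finset V) (p : ℕ → V) (n : ℕ) : Prop where
  mem : ∀ k ≤ n, p k ∈ s
  inj : ∀ k ≤ n, ∀ l ≤ n, p k = p l → k = l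
  adj : ∀ k < n, G.Adj (p k) (p (k + 1))

namespace IsPathIn

variable {s : Finset V} {p : ℕ → V} {n : ℕ}

lemma lt_card (h : G.IsPathIn s p n) : n < s.card := by
  have := Finset.card_le_card_of_injOn (s := Finset.range (n + 1)) (t := s) p
    (fun k hk => h.mem k (by simpa [Nat.lt_succ_iff] using hk))
    (fun k hk l hl hkl => h.inj k (by simpa [Nat.lt_succ_iff] using hk)
      l (by simpa [Nat.lt_succ_iff] using hl) hkl)
  simpa using this

/-- A path can be extended at its start by a neighbour not on it. -/
lemma cons (h : G.IsPathIn s p n) {w : V} (hw : w ∈ s) (hadj : G.Adj w (p 0))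
    (hnot : ∀ k ≤ n, p k ≠ w) :
    G.IsPathIn s (fun k => if k = 0 then w else p (k - 1)) (n + 1) where
  mem k hk := by
    split_ifs
    · exact hw
    · exact h.mem _ (by omega)
  inj k hk l hl hkl := by
    have h1 := hnot (k - 1) (by omega)
    have h2 := hnot (l - 1) (by omega)
    have h3 := h.inj (k - 1) (by omega) (l - 1) (by omega)
    split_ifs at hkl with hk0 hl0 hl0
    · omega
    · exact absurd hkl.symm h2
    · exact absurd hkl h1
    · have := h3 hkl
      omega
  adj k hk := by
    rcases k with _ | k
    · simpa using hadj
    · simpa using h.adj k (by omega)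

/-- If `p 0` is adjacent to `p i`, reversing the segment before `p i` yields a path again. -/
lemma rotate (h : G.IsPathIn s p n) {i : ℕ} (hi : 0 < i) (hin : i ≤ n)
    (hadj : G.Adj (p 0) (p i)) :
    G.IsPathIn s (fun k => if k < i then p (i - 1 - k) else p k) n where
  mem k hk := by
    split_ifs <;> exact h.mem _ (by omega)
  inj k hk l hl hkl := by
    split_ifs at hkl <;> have := h.inj _ (by omega) _ (by omega) hkl <;> omega
  adj k hk := by
    rcases lt_trichotomy (k + 1) i with hlt | heq | hgt
    · have := h.adj (i - 1 - (k + 1)) (by omega)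
      rw [show i - 1 - (k + 1) + 1 = i - 1 - k by omega] at this
      simpa [hlt, show k < i by omega] using this.symm
    · subst heq
      simpa using hadj
    · simpa [show ¬ k < i by omega, show ¬ k + 1 < i by omega] using h.adj k hk

lemma induce_image_Icc_connected (h : G.IsPathIn s p n) {a b : ℕ} (hab : a ≤ b) (hb : b ≤ n) :
    (G.induce (p '' Set.Icc a b)).Connected := by
  rw [connected_iff_exists_forall_reachable]
  refine ⟨⟨p a, a, ⟨le_rfl, hab⟩, rfl⟩, ?_⟩
  rintro ⟨_, k, ⟨hak, hkb⟩, rfl⟩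
  induction k, hak using Nat.le_induction with
  | base => exact Reachable.refl _
  | succ k hak ih =>
    refine (ih (by omega)).trans (Adj.reachable ?_)
    exact h.adj k (by omega)

end IsPathIn

/-- A graph with a nonempty induced subgraph of minimum degree at least three has a
`K₄` minor. -/
lemma hasMinor_K4_of_three_le_degree {s : Finset V} (hs : s.Nonempty)
    (hdeg : ∀ v ∈ s, ∀ a b, ∃ w ∈ s, G.Adj v w ∧ w ≠ a ∧ w ≠ b) :
    G.HasMinor (completeGraph (Fin 4)) := by
  classical
  obtain ⟨v₀, hv₀⟩ := hs
  obtain ⟨n, ⟨p₀, hp₀⟩, hmax⟩ :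
      ∃ n, (∃ p, G.IsPathIn s p n) ∧ ∀ p, ¬ G.IsPathIn s p (n + 1) := by
    by_contra! hcon
    have hall : ∀ n, ∃ p, G.IsPathIn s p n := by
      intro n
      induction n with
      | zero => exact ⟨fun _ => v₀, fun _ _ => hv₀, fun _ _ _ _ _ => by omega, fun _ h => by omega⟩
      | succ n ih => exact hcon n ih
    obtain ⟨p, hp⟩ := hall s.card
    exact lt_irrefl _ hp.lt_card
  have hnbr : ∀ p, G.IsPathIn s p n → ∀ k l, ∃ m ≤ n, m ≠ 0 ∧ m ≠ k ∧ m ≠ l ∧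
      G.Adj (p 0) (p m) := by
    intro p hp k l
    obtain ⟨w, hw, hadj, hk, hl⟩ := hdeg (p 0) (hp.mem 0 (by omega)) (p k) (p l)
    by_cases hon : ∃ m ≤ n, p m = w
    · obtain ⟨m, hm, rfl⟩ := hon
      refine ⟨m, hm, ?_, ?_, ?_, hadj⟩ <;> rintro rfl
      · exact hadj.ne rfl
      · exact hk rfl
      · exact hl rfl
    · push Not at hon
      exact absurd (hp.cons hw hadj.symm hon) (hmax _)
  have hchord : ∃ t p, G.IsPathIn s p n ∧ t + 2 ≤ n ∧ G.Adj (p 0) (p (t + 2)) := by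
    obtain ⟨m, hm, h0, h1, -, hadj⟩ := hnbr p₀ hp₀ 1 1
    refine ⟨m - 2, p₀, hp₀, by omega, ?_⟩
    rwa [show m - 2 + 2 = m by omega]
  obtain ⟨p, hp, htn, hadj⟩ := Nat.find_spec hchord
  have hmin : ∀ r < Nat.find hchord, ∀ q, G.IsPathIn s q n → ¬ G.Adj (q 0) (q (r + 2)) :=
    fun r hr q hq h => Nat.find_min hchord hr ⟨q, hq, by omega, h⟩
  generalize Nat.find hchord = t at *
  obtain ⟨j, hjn, hj0, hj1, hji, hj⟩ := hnbr p hp 1 (t + 2)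
  have htj : t + 3 ≤ j := by
    by_contra hlt
    refine hmin (j - 2) (by omega) p hp ?_
    rwa [show j - 2 + 2 = j by omega]
  have hq := hp.rotate (by omega) htn hadj
  obtain ⟨m, hmn, hm0, hm1, hmi, hm⟩ := hnbr _ hq 1 (t + 2)
  have htm : t + 3 ≤ m := by
    by_contra hlt
    refine hmin (m - 2) (by omega) _ hq ?_
    rwa [show m - 2 + 2 = m by omega]
  have hm' : G.Adj (p (t + 1)) (p m) := by
    simpa [show ¬ m < t + 2 by omega] using hm
  have hlast := hp.adj (t + 2) (by omega)
  let lo : Fin 4 → ℕ := ![0, t + 1, t + 2, t + 3]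
  let hi : Fin 4 → ℕ := ![t, t + 1, t + 2, n]
  have hedge : ∀ a b : Fin 4, a < b → ∃ x ∈ p '' Set.Icc (lo a) (hi a),
      ∃ y ∈ p '' Set.Icc (lo b) (hi b), G.Adj x y := by
    have key : ∀ (a b : Fin 4) (k l : ℕ), lo a ≤ k → k ≤ hi a → lo b ≤ l → l ≤ hi b →
        G.Adj (p k) (p l) → ∃ x ∈ p '' Set.Icc (lo a) (hi a),
          ∃ y ∈ p '' Set.Icc (lo b) (hi b), G.Adj x y :=
      fun a b k l h1 h2 h3 h4 h => ⟨p k, ⟨k, ⟨h1, h2⟩, rfl⟩, p l, ⟨l, ⟨h3, h4⟩, rfl⟩, h⟩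
    intro a b hab
    fin_cases a <;> fin_cases b <;> try exact absurd hab (by decide)
    · exact key 0 1 t (t + 1) (by simp [lo]) (by simp [hi]) (by simp [lo]) (by simp [hi])
        (hp.adj t (by omega))
    · exact key 0 2 0 (t + 2) (by simp [lo]) (by simp [hi]) (by simp [lo]) (by simp [hi]) hadj
    · exact key 0 3 0 j (by simp [lo]) (by simp [hi]) (by simpa [lo]) (by simpa [hi]) hj
    · exact key 1 2 (t + 1) (t + 2) (by simp [lo]) (by simp [hi]) (by simp [lo]) (by simp [hi])
        (hp.adj (t + 1) (by omega))
    · exact key 1 3 (t + 1) m (by simp [lo]) (by simp [hi]) (by simpa [lo]) (by simpa [hi]) hm'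
    · exact key 2 3 (t + 2) (t + 3) (by simp [lo]) (by simp [hi]) (by simp [lo])
        (by simp [hi]; omega) hlast
  have hhi : ∀ a, lo a ≤ hi a ∧ hi a ≤ n := by
    intro a
    fin_cases a <;> simp [lo, hi] <;> omega
  have hlohi : ∀ a b, a < b → hi a < lo b := by
    intro a b hab
    fin_cases a <;> fin_cases b <;> first | exact absurd hab (by decide) | (simp [lo, hi])
  refine ⟨fun a => p '' Set.Icc (lo a) (hi a), fun a =>
    hp.induce_image_Icc_connected (hhi a).1 (hhi a).2, ?_, ?_⟩
  · intro a b hab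
    rw [Set.disjoint_left]
    rintro _ ⟨k, ⟨hk1, hk2⟩, rfl⟩ ⟨l, ⟨hl1, hl2⟩, hkl⟩
    have := hp.inj l (hl2.trans (hhi b).2) k (hk2.trans (hhi a).2) hkl
    rcases lt_or_gt_of_ne hab with h | h <;> have := hlohi _ _ h <;> omega
  · intro a b hab
    rcases lt_or_gt_of_ne hab.ne with h | h
    · exact hedge a b h
    · obtain ⟨x, hx, y, hy, hxy⟩ := hedge b a h
      exact ⟨y, hy, x, hx, hxy.symm⟩

/-- A finite graph without a `K₄` minor is 3-colorable. -/
theorem colorable_three_of_not_hasMinor_K4 [Fintype V]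
    (h : ¬ G.HasMinor (completeGraph (Fin 4))) : G.Colorable 3 := by
  classical
  have key : ∀ s : Finset V, ∃ c : V → Fin 3, ∀ x ∈ s, ∀ y ∈ s, G.Adj x y → c x ≠ c y := by
    intro s
    induction s using Finset.strongInduction with
    | H s ih =>
      rcases s.eq_empty_or_nonempty with rfl | hs
      · exact ⟨fun _ => 0, by simp⟩
      have hlow : ∃ v ∈ s, ∃ a b, ∀ w ∈ s, G.Adj v w → w = a ∨ w = b := by
        by_contra! hcon
        exact h (hasMinor_K4_of_three_le_degree hs hcon)
      obtain ⟨v, hv, a, b, hab⟩ := hlow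
      obtain ⟨c, hc⟩ := ih (s.erase v) (Finset.erase_ssubset hv)
      obtain ⟨d, hda, hdb⟩ : ∃ d : Fin 3, d ≠ c a ∧ d ≠ c b := by
        generalize c a = i
        generalize c b = j
        revert i j
        decide
      have hd : ∀ w ∈ s, G.Adj v w → d ≠ c w := by
        intro w hw hvw
        rcases hab w hw hvw with rfl | rfl <;> assumption
      refine ⟨Function.update c v d, fun x hx y hy hxy => ?_⟩
      by_cases hxv : x = v
      · subst hxv
        simpa [Function.update_of_ne hxy.ne'] using hd y hy hxy
      · by_cases hyv : y = v
        · subst hyv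
          simpa [Function.update_of_ne hxy.ne] using (hd x hx hxy.symm).symm
        · simpa [Function.update_of_ne, hxv, hyv] using
            hc x (Finset.mem_erase.2 ⟨hxv, hx⟩) y (Finset.mem_erase.2 ⟨hyv, hy⟩) hxy
  obtain ⟨c, hc⟩ := key Finset.univ
  exact ⟨Coloring.mk c fun {x y} hxy => hc x (Finset.mem_univ x) y (Finset.mem_univ y) hxy⟩

end SimpleGraph

/-- Every proper 3-coloring gives the two diamond vertices of a diamond the same color. -/
lemma IsDiamondCopy.coloring_eq {V : Type*} {G : SimpleGraph V} {f : Fin 4 → V}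
    (hD : IsDiamondCopy G f) (c : G.Coloring (Fin 3)) : c (f 0) = c (f 1) := by
  have h02 := c.valid (hD.2 (show diamondGraph.Adj 0 2 by simp [diamondGraph]))
  have h03 := c.valid (hD.2 (show diamondGraph.Adj 0 3 by simp [diamondGraph]))
  have h12 := c.valid (hD.2 (show diamondGraph.Adj 1 2 by simp [diamondGraph]))
  have h13 := c.valid (hD.2 (show diamondGraph.Adj 1 3 by simp [diamondGraph]))
  have h23 := c.valid (hD.2 (show diamondGraph.Adj 2 3 by simp [diamondGraph]))
  omega

theorem precoloring_diamond_vertices_same_color_twoConnected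
    {V : Type*} [Fintype V] (G : SimpleGraph V)
    (hout : G.Outerplanar) (h2c : G.TwoConnected)
    (htri : {t : Finset V | G.IsNClique 3 t}.ncard = 2)
    (f : Fin 4 → V) (hD : IsDiamondCopy G f)
    (c₀ : Fin 3) :
    ∃ c : G.Coloring (Fin 3), c (f 0) = c₀ ∧ c (f 1) = c₀ := by
  obtain ⟨c⟩ := SimpleGraph.colorable_three_of_not_hasMinor_K4 hout.1
  let σ : Equiv.Perm (Fin 3) := Equiv.swap (c (f 0)) c₀
  refine ⟨SimpleGraph.Coloring.mk (fun x => σ (c x))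
    fun {x y} hxy h => c.valid hxy (σ.injective h), ?_, ?_⟩
  · exact Equiv.swap_apply_left _ _
  · change σ (c (f 1)) = c₀
    rw [← hD.coloring_eq c]
    exact Equiv.swap_apply_left _ _
end

section
/- Let G be a finite simple connected outerplanar graph containing exactly two triangles, and suppose G has no subgraph isomorphic to the diamond (K₄ minus one edge). Then for any two nonadjacent vertices u, v of G, every assignment of colors from a 3-element color set to u and v extends to a proper 3-coloring of G. -/
namespace SimpleGraph

variable {V : Type*} {G : SimpleGraph V}

/-- `c` is proper on the subgraph of `G` induced by `S`. -/
def ProperOn (G : SimpleGraph V) (S : Set V) (c : V → Fin 3) : Prop :=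
  ∀ x ∈ S, ∀ y ∈ S, G.Adj x y → c x ≠ c y

/-- Every precoloring of two nonadjacent vertices of `S` extends to `G[S]`. -/
def PairExtendable (G : SimpleGraph V) (S : Set V) : Prop :=
  ∀ u ∈ S, ∀ v ∈ S, u ≠ v → ¬ G.Adj u v → ∀ c₁ c₂ : Fin 3,
    ∃ c, G.ProperOn S c ∧ c u = c₁ ∧ c v = c₂

theorem ProperOn.comp_perm {S : Set V} {c : V → Fin 3} (h : G.ProperOn S c)
    (σ : Equiv.Perm (Fin 3)) : G.ProperOn S (σ ∘ c) :=
  fun x hx y hy hxy he => h x hx y hy hxy (σ.injective he)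

theorem ProperOn.glue {S A B : Set V} {a b : V → Fin 3} (hS : S ⊆ A ∪ B)
    (ha : G.ProperOn A a) (hb : G.ProperOn B b) (hab : ∀ x ∈ A, x ∈ B → a x = b x)
    (hcross : ∀ x ∈ A, x ∉ B → ∀ y ∈ B, y ∉ A → ¬ G.Adj x y) :
    ∃ c, G.ProperOn S c ∧ (∀ x ∈ A, c x = a x) ∧ ∀ x ∈ B, c x = b x := by
  classical
  have h1 : ∀ x ∈ A, (if x ∈ A then a x else b x) = a x := fun x hx => if_pos hx
  have h2 : ∀ x ∈ B, (if x ∈ A then a x else b x) = b x := fun x hx => by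
    by_cases h : x ∈ A
    · rw [if_pos h, hab x h hx]
    · rw [if_neg h]
  refine ⟨fun x => if x ∈ A then a x else b x, fun x hx y hy hxy => ?_, h1, h2⟩
  change (if x ∈ A then a x else b x) ≠ (if y ∈ A then a y else b y)
  by_cases hxA : x ∈ A <;> by_cases hyA : y ∈ A
  · rw [h1 x hxA, h1 y hyA]; exact ha x hxA y hyA hxy
  · have hyB := (hS hy).resolve_left hyA
    by_cases hxB : x ∈ B
    · rw [h2 x hxB, h2 y hyB]; exact hb x hxB y hyB hxy
    · exact absurd hxy (hcross x hxA hxB y hyB hyA)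
  · have hxB := (hS hx).resolve_left hxA
    by_cases hyB : y ∈ B
    · rw [h2 x hxB, h2 y hyB]; exact hb x hxB y hyB hxy
    · exact absurd hxy.symm (hcross y hyA hyB x hxB hxA)
  · have hxB := (hS hx).resolve_left hxA
    have hyB := (hS hy).resolve_left hyA
    rw [h2 x hxB, h2 y hyB]; exact hb x hxB y hyB hxy

theorem isDiamondCopy_of_pairwise_adj {f : Fin 4 → V} (hf : ∀ i j, i ≠ j → G.Adj (f i) (f j)) :
    IsDiamondCopy G f := by
  refine ⟨fun i j h => ?_, fun a b h => hf a b h.ne⟩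
  by_contra hij
  exact (hf i j hij).ne h

theorem PairExtendable.exists_properOn [Finite V] (hd : ¬ ∃ f : Fin 4 → V, IsDiamondCopy G f)
    {S : Set V} (hS : G.PairExtendable S) : ∃ c, G.ProperOn S c := by
  classical
  have := Fintype.ofFinite V
  by_cases hcl : ∀ x ∈ S, ∀ y ∈ S, x ≠ y → G.Adj x y
  · by_cases hcard : Fintype.card S ≤ 3
    · obtain ⟨e⟩ := Function.Embedding.nonempty_of_card_le (α := S) (β := Fin 3) (by simpa using hcard)
      refine ⟨fun x => if h : x ∈ S then e ⟨x, h⟩ else 0, fun x hx y hy hxy he => hxy.ne ?_⟩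
      simp only [hx, hy, dif_pos] at he
      simpa using e.injective he
    · obtain ⟨e⟩ := Function.Embedding.nonempty_of_card_le (α := Fin 4) (β := S)
        (by simp only [Fintype.card_fin]; omega)
      exact absurd ⟨_, isDiamondCopy_of_pairwise_adj (f := fun i => (e i : V)) fun i j hij =>
        hcl _ (e i).2 _ (e j).2 fun h => hij (e.injective (Subtype.ext h))⟩ hd
  · push Not at hcl
    obtain ⟨x, hx, y, hy, hxy, hadj⟩ := hcl
    obtain ⟨c, hc, -⟩ := hS x hx y hy hxy hadj 0 0
    exact ⟨c, hc⟩

theorem exists_perm_map_one (a b : Fin 3) : ∃ σ : Equiv.Perm (Fin 3), σ a = b :=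
  ⟨Equiv.swap a b, Equiv.swap_apply_left a b⟩

theorem exists_perm_map_two :
    ∀ a b c d : Fin 3, a ≠ b → c ≠ d → ∃ σ : Equiv.Perm (Fin 3), σ a = c ∧ σ b = d := by
  decide

theorem PairExtendable.exists_properOn_one [Finite V]
    (hd : ¬ ∃ f : Fin 4 → V, IsDiamondCopy G f)
    {S : Set V} (hS : G.PairExtendable S) (u : V) (c₁ : Fin 3) :
    ∃ c, G.ProperOn S c ∧ c u = c₁ := by
  obtain ⟨c, hc⟩ := hS.exists_properOn hd
  obtain ⟨σ, hσ⟩ := exists_perm_map_one (c u) c₁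
  exact ⟨σ ∘ c, hc.comp_perm σ, hσ⟩

theorem PairExtendable.exists_properOn_ne [Finite V]
    (hd : ¬ ∃ f : Fin 4 → V, IsDiamondCopy G f)
    {S : Set V} (hS : G.PairExtendable S) {u v : V} (hu : u ∈ S) (hv : v ∈ S) (huv : u ≠ v)
    {c₁ c₂ : Fin 3} (h : c₁ ≠ c₂) :
    ∃ c, G.ProperOn S c ∧ c u = c₁ ∧ c v = c₂ := by
  by_cases hadj : G.Adj u v
  · obtain ⟨c, hc⟩ := hS.exists_properOn hd
    obtain ⟨σ, h1, h2⟩ := exists_perm_map_two (c u) (c v) c₁ c₂ (hc u hu v hv hadj) h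
    exact ⟨σ ∘ c, hc.comp_perm σ, h1, h2⟩
  · exact hS u hu v hv huv hadj c₁ c₂

theorem exists_ne_ne : ∀ a b : Fin 3, ∃ c, c ≠ a ∧ c ≠ b := by decide

/-- Extendability is inherited from the two sides of a separation of order at most one. -/
theorem PairExtendable.of_separation [Finite V] (hd : ¬ ∃ f : Fin 4 → V, IsDiamondCopy G f)
    {S A B : Set V} (hS : S = A ∪ B) (hA : G.PairExtendable A) (hB : G.PairExtendable B)
    (hsub : (A ∩ B).Subsingleton)
    (hcross : ∀ x ∈ A, x ∉ B → ∀ y ∈ B, y ∉ A → ¬ G.Adj x y) : G.PairExtendable S := by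
  have one_side : ∀ {A B : Set V}, S = A ∪ B → G.PairExtendable A → G.PairExtendable B →
      (A ∩ B).Subsingleton → (∀ x ∈ A, x ∉ B → ∀ y ∈ B, y ∉ A → ¬ G.Adj x y) →
      ∀ u ∈ A, ∀ v ∈ A, u ≠ v → ¬ G.Adj u v → ∀ c₁ c₂ : Fin 3,
        ∃ c, G.ProperOn S c ∧ c u = c₁ ∧ c v = c₂ := by
    intro A B hS hA hB hsub hcross u hu v hv huv hadj c₁ c₂
    obtain ⟨a, ha, hau, hav⟩ := hA u hu v hv huv hadj c₁ c₂
    obtain ⟨b, hb, hab⟩ : ∃ b, G.ProperOn B b ∧ ∀ x ∈ A, x ∈ B → a x = b x := by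
      by_cases hne : (A ∩ B).Nonempty
      · obtain ⟨w, hw⟩ := hne
        obtain ⟨b, hb, hbw⟩ := hB.exists_properOn_one hd w (a w)
        refine ⟨b, hb, fun x hx hx' => ?_⟩
        rw [hsub ⟨hx, hx'⟩ hw, hbw]
      · obtain ⟨b, hb⟩ := hB.exists_properOn hd
        exact ⟨b, hb, fun x hx hx' => absurd ⟨x, hx, hx'⟩ hne⟩
    obtain ⟨c, hc, hca, -⟩ := ha.glue hS.le hb hab hcross
    exact ⟨c, hc, by rw [hca u hu, hau], by rw [hca v hv, hav]⟩
  have two_sides : ∀ u ∈ A, u ∉ B → ∀ v ∈ B, v ∉ A → ∀ c₁ c₂ : Fin 3,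
      ∃ c, G.ProperOn S c ∧ c u = c₁ ∧ c v = c₂ := by
    intro u hu huB v hv hvA c₁ c₂
    obtain ⟨a, b, ha, hb, hau, hbv, hab⟩ : ∃ a b, G.ProperOn A a ∧ G.ProperOn B b ∧ a u = c₁ ∧
        b v = c₂ ∧ ∀ x ∈ A, x ∈ B → a x = b x := by
      by_cases hne : (A ∩ B).Nonempty
      · obtain ⟨w, hwA, hwB⟩ := hne
        obtain ⟨c₃, h1, h2⟩ := exists_ne_ne c₁ c₂
        obtain ⟨a, ha, hau, haw⟩ := hA.exists_properOn_ne hd hu hwA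
          (fun h => huB (h ▸ hwB)) h1.symm
        obtain ⟨b, hb, hbv, hbw⟩ := hB.exists_properOn_ne hd hv hwB
          (fun h => hvA (h ▸ hwA)) h2.symm
        refine ⟨a, b, ha, hb, hau, hbv, fun x hx hx' => ?_⟩
        rw [hsub ⟨hx, hx'⟩ ⟨hwA, hwB⟩, haw, hbw]
      · obtain ⟨a, ha, hau⟩ := hA.exists_properOn_one hd u c₁
        obtain ⟨b, hb, hbv⟩ := hB.exists_properOn_one hd v c₂
        exact ⟨a, b, ha, hb, hau, hbv, fun x hx hx' => absurd ⟨x, hx, hx'⟩ hne⟩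
    obtain ⟨c, hc, hca, hcb⟩ := ha.glue hS.le hb hab hcross
    exact ⟨c, hc, by rw [hca u hu, hau], by rw [hcb v hv, hbv]⟩
  have hS' : S = B ∪ A := hS.trans (Set.union_comm A B)
  have hcross' : ∀ x ∈ B, x ∉ A → ∀ y ∈ A, y ∉ B → ¬ G.Adj x y :=
    fun x hx hx' y hy hy' h => hcross y hy hy' x hx hx' h.symm
  intro u hu v hv huv hadj c₁ c₂
  by_cases h1 : u ∈ A ∧ v ∈ A
  · exact one_side hS hA hB hsub hcross u h1.1 v h1.2 huv hadj c₁ c₂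
  by_cases h2 : u ∈ B ∧ v ∈ B
  · exact one_side hS' hB hA (Set.inter_comm A B ▸ hsub) hcross' u h2.1 v h2.2 huv hadj c₁ c₂
  rw [hS] at hu hv
  by_cases huA : u ∈ A
  · have hvA : v ∉ A := fun h => h1 ⟨huA, h⟩
    have hvB := hv.resolve_left hvA
    exact two_sides u huA (fun h => h2 ⟨h, hvB⟩) v hvB hvA c₁ c₂
  · have huB := hu.resolve_left huA
    have hvB : v ∉ B := fun h => h2 ⟨huB, h⟩
    obtain ⟨c, hc, h, h'⟩ := two_sides v (hv.resolve_right hvB) hvB u huB huA c₂ c₁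
    exact ⟨c, hc, h', h⟩

/-- A vertex with at most two neighbors in `S` does not obstruct extending a precoloring. -/
theorem exists_third_neighbor {S : Set V} {u v : V} {c₁ c₂ : Fin 3}
    (hno : ¬ ∃ c, G.ProperOn S c ∧ c u = c₁ ∧ c v = c₂) {x : V}
    (hx : ∃ c, G.ProperOn (S \ {x}) c ∧ c u = c₁ ∧ c v = c₂) (hxu : x ≠ u) (hxv : x ≠ v)
    (a b : V) : ∃ y ∈ S, G.Adj x y ∧ y ≠ a ∧ y ≠ b := by
  classical
  by_contra! hcon
  obtain ⟨c, hc, hcu, hcv⟩ := hx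
  obtain ⟨d, hda, hdb⟩ := exists_ne_ne (c a) (c b)
  have key : ∀ y ∈ S, G.Adj x y → d ≠ c y := by
    intro y hy hxy
    by_cases hya : y = a
    · rwa [hya]
    · rwa [hcon y hy hxy hya]
  refine hno ⟨Function.update c x d, fun y hy z hz hyz => ?_, ?_, ?_⟩
  · by_cases hyx : y = x
    · subst hyx
      rw [Function.update_self, Function.update_of_ne hyz.ne']
      exact key z hz hyz
    · by_cases hzx : z = x
      · subst hzx
        rw [Function.update_self, Function.update_of_ne hyx]
        exact (key y hy hyz.symm).symm
      · rw [Function.update_of_ne hyx, Function.update_of_ne hzx]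
        exact hc y ⟨hy, hyx⟩ z ⟨hz, hzx⟩ hyz
  · rw [Function.update_of_ne hxu.symm, hcu]
  · rw [Function.update_of_ne hxv.symm, hcv]

theorem hasMinor_completeGraph_four {A B C D : Set V}
    (hA : (G.induce A).Connected) (hB : (G.induce B).Connected)
    (hC : (G.induce C).Connected) (hD : (G.induce D).Connected)
    (dAB : Disjoint A B) (dAC : Disjoint A C) (dAD : Disjoint A D)
    (dBC : Disjoint B C) (dBD : Disjoint B D) (dCD : Disjoint C D)
    (eAB : ∃ a ∈ A, ∃ b ∈ B, G.Adj a b) (eAC : ∃ a ∈ A, ∃ b ∈ C, G.Adj a b)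
    (eAD : ∃ a ∈ A, ∃ b ∈ D, G.Adj a b) (eBC : ∃ a ∈ B, ∃ b ∈ C, G.Adj a b)
    (eBD : ∃ a ∈ B, ∃ b ∈ D, G.Adj a b) (eCD : ∃ a ∈ C, ∃ b ∈ D, G.Adj a b) :
    G.HasMinor (completeGraph (Fin 4)) := by
  have sw : ∀ {X Y : Set V}, (∃ a ∈ X, ∃ b ∈ Y, G.Adj a b) → ∃ a ∈ Y, ∃ b ∈ X, G.Adj a b :=
    fun ⟨a, ha, b, hb, h⟩ => ⟨b, hb, a, ha, h.symm⟩
  refine ⟨![A, B, C, D], ?_, ?_, ?_⟩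
  · intro w
    fin_cases w
    exacts [hA, hB, hC, hD]
  · intro i j hij
    fin_cases i <;> fin_cases j
    exacts [absurd rfl hij, dAB, dAC, dAD, dAB.symm, absurd rfl hij, dBC, dBD,
      dAC.symm, dBC.symm, absurd rfl hij, dCD, dAD.symm, dBD.symm, dCD.symm, absurd rfl hij]
  · intro i j hij
    fin_cases i <;> fin_cases j
    exacts [absurd rfl hij.ne, eAB, eAC, eAD, sw eAB, absurd rfl hij.ne, eBC, eBD,
      sw eAC, sw eBC, absurd rfl hij.ne, eCD, sw eAD, sw eBD, sw eCD, absurd rfl hij.ne]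

theorem hasMinor_completeBipartiteGraph_two_three {x y : V} (hxy : x ≠ y) {P : Fin 3 → Set V}
    (hP : ∀ i, (G.induce (P i)).Connected) (hd : Pairwise fun i j => Disjoint (P i) (P j))
    (hxP : ∀ i, x ∉ P i) (hyP : ∀ i, y ∉ P i)
    (hx : ∀ i, ∃ a ∈ P i, G.Adj x a) (hy : ∀ i, ∃ a ∈ P i, G.Adj y a) :
    G.HasMinor (completeBipartiteGraph (Fin 2) (Fin 3)) := by
  have hz : ∀ i : Fin 2, ∀ j, (![x, y] i) ∉ P j := by
    intro i; fin_cases i; exacts [hxP, hyP]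
  have hzP : ∀ i : Fin 2, ∀ j, ∃ a ∈ P j, G.Adj (![x, y] i) a := by
    intro i; fin_cases i; exacts [hx, hy]
  refine ⟨Sum.elim (fun i => {![x, y] i}) P, ?_, ?_, ?_⟩
  · rintro (i | j)
    · simp only [Sum.elim_inl]
      exact G.induce_singleton_eq_top _ ▸ connected_top
    · exact hP j
  · rintro (i | i) (j | j) hij
    · simp only [Sum.elim_inl, Set.disjoint_singleton]
      fin_cases i <;> fin_cases j
      exacts [absurd rfl hij, hxy, hxy.symm, absurd rfl hij]
    · exact Set.disjoint_singleton_left.2 (hz i j)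
    · exact Set.disjoint_singleton_right.2 (hz j i)
    · exact hd fun h => hij (h ▸ rfl)
  · rintro (i | i) (j | j) hij
    · simp at hij
    · obtain ⟨a, ha, h⟩ := hzP i j
      exact ⟨_, rfl, a, ha, h⟩
    · obtain ⟨a, ha, h⟩ := hzP j i
      exact ⟨a, ha, _, rfl, h.symm⟩
    · simp at hij

theorem connected_induce_of_isChain {s : List V} (hs : s ≠ []) :
    ∀ {a b : V}, (a :: (s ++ [b])).IsChain G.Adj →
      (G.induce {x | x ∈ s}).Connected ∧ (∃ x ∈ s, G.Adj a x) ∧ ∃ x ∈ s, G.Adj b x := by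
  induction s with
  | nil => exact absurd rfl hs
  | cons x s ih =>
    intro a b h
    rw [List.cons_append, List.isChain_cons_cons] at h
    have hx : (G.induce {x}).Connected := G.induce_singleton_eq_top x ▸ connected_top
    by_cases hs' : s = []
    · subst hs'
      simp only [List.nil_append, List.isChain_pair] at h
      refine ⟨?_, ⟨x, by simp, h.1⟩, ⟨x, by simp, h.2.symm⟩⟩
      rwa [show {y | y ∈ [x]} = ({x} : Set V) by ext; simp]
    · obtain ⟨h1, ⟨y, hy, hxy⟩, z, hz, hbz⟩ := ih hs' h.2
      refine ⟨?_, ⟨x, by simp, h.1⟩, ⟨z, by simp [hz], hbz⟩⟩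
      have := connected_induce_union hx.preconnected h1.preconnected (v := x) (w := y) rfl hy hxy
      convert this using 2
      all_goals ext; simp

/-- A nonempty list of distinct vertices, cyclically adjacent in `G`. -/
def IsCyclicList (G : SimpleGraph V) (l : List V) : Prop :=
  (l : Cycle V).Chain G.Adj ∧ l.Nodup ∧ 2 ≤ l.length

/-- In a graph without `K_{2,3}` minor, a cycle with an external path between two of its vertices
can be enlarged. -/
theorem IsCyclicList.exists_longer (hK : ¬ G.HasMinor (completeBipartiteGraph (Fin 2) (Fin 3)))
    {l p : List V} (hl : G.IsCyclicList l) {c z : V} (hc : c ∈ l) (hz : z ∈ l) (hzc : z ≠ c)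
    (hp0 : p ≠ []) (hp : p.Nodup) (hpl : ∀ x ∈ p, x ∉ l)
    (hch : (c :: (p ++ [z])).IsChain G.Adj) :
    ∃ l', G.IsCyclicList l' ∧ l.length < l'.length ∧ ∀ x ∈ l', x ∈ l ∨ x ∈ p := by
  obtain ⟨r, hr⟩ : ∃ r, l ~r c :: r := by
    obtain ⟨s, t, rfl⟩ := List.append_of_mem hc
    exact ⟨t ++ s, by simpa using List.isRotated_append (l := s) (l' := c :: t)⟩
  obtain ⟨hchain, hnd, hlen⟩ := hl
  rw [Cycle.coe_eq_coe.2 hr, Cycle.chain_coe_cons] at hchain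
  have hmem : ∀ x, x ∈ l ↔ x ∈ c :: r := fun x => hr.mem_iff
  have hnd' := hr.nodup_iff.1 hnd
  have hlen' := hr.perm.length_eq
  have hzr : z ∈ r := by
    have := (hmem z).1 hz
    simpa [hzc] using this
  obtain ⟨s, t, rfl⟩ := List.append_of_mem hzr
  have hsplit : (c :: (s ++ [z])).IsChain G.Adj ∧ (z :: (t ++ [c])).IsChain G.Adj := by
    have := (List.isChain_split (R := G.Adj) (l₁ := c :: s) (c := z) (l₂ := t ++ [c])).1
      (by simpa using hchain)
    simpa using this
  have hp1 : 0 < p.length := List.length_pos_iff.2 hp0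
  simp only [hmem] at hpl ⊢
  simp only [List.nodup_cons, List.nodup_append, List.mem_append, List.mem_cons, not_or] at hnd' hpl
  by_cases hs : s = []
  · subst hs
    refine ⟨c :: (p ++ z :: t), ⟨?_, ?_, ?_⟩, ?_, ?_⟩
    · rw [Cycle.chain_coe_cons]
      have := (List.isChain_split (R := G.Adj) (l₁ := c :: p) (c := z) (l₂ := t ++ [c])).2
        ⟨by simpa using hch, by simpa using hsplit.2⟩
      simpa using this
    · simp only [List.nodup_cons, List.nodup_append, List.mem_append, List.mem_cons, not_or]
      grind
    · simp; omega
    · simp at hlen' ⊢; omega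
    · intro x hx
      simp at hx ⊢; tauto
  by_cases ht : t = []
  · subst ht
    refine ⟨c :: (s ++ z :: p.reverse), ⟨?_, ?_, ?_⟩, ?_, ?_⟩
    · rw [Cycle.chain_coe_cons]
      have hrev : (z :: (p.reverse ++ [c])).IsChain G.Adj := by
        have := List.isChain_reverse.2 (hch.imp fun a b h => h.symm)
        simpa using this
      have := (List.isChain_split (R := G.Adj) (l₁ := c :: s) (c := z) (l₂ := p.reverse ++ [c])).2
        ⟨by simpa using hsplit.1, by simpa using hrev⟩
      simpa using this
    · simp only [List.nodup_cons, List.nodup_append, List.mem_append, List.mem_cons, not_or,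
        List.mem_reverse, List.nodup_reverse]
      grind
    · simp; omega
    · simp at hlen' ⊢; omega
    · intro x hx
      simp at hx ⊢; tauto
  obtain ⟨cs, cs1, cs2⟩ := connected_induce_of_isChain hs hsplit.1
  obtain ⟨ct, ct1, ct2⟩ := connected_induce_of_isChain ht hsplit.2
  obtain ⟨cp, cp1, cp2⟩ := connected_induce_of_isChain hp0 hch
  have dst : Disjoint {x | x ∈ s} {x | x ∈ t} := by
    rw [Set.disjoint_left]; grind
  have dsp : Disjoint {x | x ∈ s} {x | x ∈ p} := by
    rw [Set.disjoint_left]; grind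
  have dtp : Disjoint {x | x ∈ t} {x | x ∈ p} := by
    rw [Set.disjoint_left]; grind
  refine absurd (hasMinor_completeBipartiteGraph_two_three (x := c) (y := z) hzc.symm
    (P := ![{x | x ∈ s}, {x | x ∈ t}, {x | x ∈ p}]) ?_ ?_ ?_ ?_ ?_ ?_) hK
  · intro i; fin_cases i; exacts [cs, ct, cp]
  · intro i j hij
    fin_cases i <;> fin_cases j
    exacts [absurd rfl hij, dst, dsp, dst.symm, absurd rfl hij, dtp, dsp.symm, dtp.symm,
      absurd rfl hij]
  · intro i; fin_cases i
    · exact fun h : c ∈ s => hnd'.1.1 h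
    · exact fun h : c ∈ t => hnd'.1.2.2 h
    · exact fun h : c ∈ p => (hpl c h).1 rfl
  · intro i; fin_cases i
    · exact fun h : z ∈ s => hnd'.2.2.2 z h z (Or.inl rfl) rfl
    · exact fun h : z ∈ t => hnd'.2.2.1.1 h
    · exact fun h : z ∈ p => (hpl z h).2.2.1 rfl
  · intro i; fin_cases i; exacts [cs1, ct2, cp1]
  · intro i; fin_cases i; exacts [cs2, ct1, cp2]

/-- A set with an edge and without separations of order at most one is spanned by a cycle. -/
theorem exists_isCyclicList_of_no_separation [Finite V]
    (hK : ¬ G.HasMinor (completeBipartiteGraph (Fin 2) (Fin 3))) {S : Set V}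
    (hsep : ∀ A B : Set V, S = A ∪ B → A ≠ S → B ≠ S → (A ∩ B).Subsingleton →
      ∃ x ∈ A, x ∉ B ∧ ∃ y ∈ B, y ∉ A ∧ G.Adj x y)
    {a b : V} (ha : a ∈ S) (hb : b ∈ S) (hab : G.Adj a b) :
    ∃ l, G.IsCyclicList l ∧ ∀ x, x ∈ l ↔ x ∈ S := by
  classical
  have := Fintype.ofFinite V
  obtain ⟨l, ⟨hl, hlS⟩, hmax⟩ : ∃ l : List V, (G.IsCyclicList l ∧ ∀ x ∈ l, x ∈ S) ∧
      ∀ l', (G.IsCyclicList l' ∧ ∀ x ∈ l', x ∈ S) → l'.length ≤ l.length := by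
    let L : Set ℕ := {n | ∃ l, (G.IsCyclicList l ∧ ∀ x ∈ l, x ∈ S) ∧ l.length = n}
    have hne : L.Nonempty := by
      refine ⟨2, [a, b], ⟨⟨?_, ?_, ?_⟩, ?_⟩, rfl⟩
      · rw [Cycle.chain_coe_cons]
        simp [hab, hab.symm]
      · simp [hab.ne]
      · simp
      · simp [ha, hb]
    have hbdd : BddAbove L := by
      refine ⟨Fintype.card V, ?_⟩
      rintro n ⟨l, ⟨h, -⟩, rfl⟩
      exact h.2.1.length_le_card
    obtain ⟨l, hl, hlen⟩ := Nat.sSup_mem hne hbdd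
    exact ⟨l, hl, fun l' hl' => hlen ▸ le_csSup hbdd ⟨l', hl', rfl⟩⟩
  refine ⟨l, hl, fun x => ⟨hlS x, fun hx => ?_⟩⟩
  by_contra hxl
  obtain ⟨c₀, hc₀, d₀, hd₀, hcd₀⟩ : ∃ c ∈ l, ∃ d ∈ l, c ≠ d := by
    obtain ⟨-, hnd, hlen⟩ := hl
    match l, hnd, hlen with
    | c :: d :: t, hnd, _ => exact ⟨c, by simp, d, by simp, by grind⟩
  obtain ⟨c, hc, -, x, ⟨hxS, hxl⟩, -, hcx⟩ := hsep {x | x ∈ l} (S \ {x | x ∈ l})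
    (Set.union_sdiff_cancel fun x hx => hlS x hx).symm (fun h => hxl (h.ge hx))
    (fun h => (h.ge (hlS _ hc₀)).2 hc₀)
    (by rw [Set.inter_sdiff_self]; exact Set.subsingleton_empty)
  change c ∈ l at hc
  change x ∉ l at hxl
  let K : Set V := {y | ∃ w : G.Walk x y, ∀ z ∈ w.support, z ∈ S ∧ z ∉ l}
  have hKS : ∀ y ∈ K, y ∈ S ∧ y ∉ l := fun y ⟨w, hw⟩ => hw y w.end_mem_support
  have hxK : x ∈ K := ⟨.nil, by simp [hxS, hxl]⟩
  obtain ⟨d, hd, hdc⟩ : ∃ d ∈ l, d ≠ c := by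
    by_cases h : c₀ = c
    · exact ⟨d₀, hd₀, h ▸ hcd₀.symm⟩
    · exact ⟨c₀, hc₀, h⟩
  obtain ⟨y, hy, hyB, z, ⟨hzS, hzK⟩, hzA, hyz⟩ := hsep (K ∪ {c}) (S \ K) (by
      ext y
      simp only [Set.mem_union, Set.mem_singleton_iff, Set.mem_sdiff]
      constructor
      · intro h; tauto
      · rintro ((h | rfl) | h)
        exacts [(hKS y h).1, hlS _ hc, h.1])
    (fun h => by
      rcases h.ge (hlS d hd) with h | h
      exacts [(hKS d h).2 hd, hdc h])
    (fun h => (h.ge hxS).2 hxK)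
    (by
      rintro p ⟨hp | hp, hp'⟩ q ⟨hq | hq, hq'⟩
      · exact absurd hp hp'.2
      · exact absurd hp hp'.2
      · exact absurd hq hq'.2
      · exact hp.trans hq.symm)
  have hzc : z ≠ c := fun h => hzA (Or.inr h)
  obtain ⟨w, hw⟩ : y ∈ K := by
    rcases hy with hy | rfl
    · exact hy
    · by_contra h
      exact hyB ⟨hlS _ hc, h⟩
  have hzl : z ∈ l := by
    by_contra hzl
    refine hzK ⟨w.concat hyz, fun q hq => ?_⟩
    rw [Walk.support_concat, List.mem_append, List.mem_singleton] at hq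
    rcases hq with hq | rfl
    exacts [hw q hq, ⟨hzS, hzl⟩]
  have hwb : ∀ q ∈ w.bypass.support, q ∈ S ∧ q ∉ l :=
    fun q hq => hw q (w.support_bypass_subset_support hq)
  obtain ⟨l', hl', hlt, hmem⟩ := hl.exists_longer hK hc hzl hzc (p := w.bypass.support)
    (by simp) w.bypass_isPath.support_nodup (fun q hq => (hwb q hq).2)
    (by
      have := (Walk.cons hcx (w.bypass.concat hyz)).isChain_adj_support
      simpa [Walk.support_concat] using this)
  have := hmax l' ⟨hl', fun q hq => (hmem q hq).elim (hlS q) fun h => (hwb q h).1⟩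
  omega

/-- `f`, of period `n`, enumerates `S` along a cycle of `G`. -/
structure IsCyclicEnum (G : SimpleGraph V) (S : Set V) (n : ℕ) (f : ℕ → V) : Prop where
  pos : 0 < n
  periodic : Function.Periodic f n
  adj : ∀ i, G.Adj (f i) (f (i + 1))
  mod_eq : ∀ i j, f i = f j → i % n = j % n
  mem_iff : ∀ x, x ∈ S ↔ ∃ i < n, f i = x

theorem IsCyclicList.exists_isCyclicEnum {l : List V} (hl : G.IsCyclicList l) {S : Set V}
    (hS : ∀ x, x ∈ l ↔ x ∈ S) : ∃ n f, G.IsCyclicEnum S n f := by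
  obtain ⟨hchain, hnd, hlen⟩ := hl
  have hpos : 0 < l.length := by omega
  have hlt : ∀ i, i % l.length < l.length := fun i => Nat.mod_lt i hpos
  refine ⟨l.length, fun i => l[i % l.length]'(hlt i), hpos, fun i => ?_, fun i => ?_,
    fun i j h => (hnd.getElem_inj_iff).1 h, fun x => ?_⟩
  · simp
  · match l, hpos with
    | a :: t, hpos =>
      rw [Cycle.chain_coe_cons, ← List.cons_append, List.isChain_iff_getElem] at hchain
      have h := hchain (i % (a :: t).length) (by simpa using hlt i)
      rw [List.getElem_append_left (hlt i)] at h
      by_cases hi : i % (a :: t).length + 1 < (a :: t).length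
      · rw [List.getElem_append_left hi] at h
        have he : (i + 1) % (a :: t).length = i % (a :: t).length + 1 := by
          rw [Nat.add_mod, Nat.mod_eq_of_lt (a := 1) (by omega), Nat.mod_eq_of_lt hi]
        simpa only [he] using h
      · have hi' : i % (a :: t).length + 1 = (a :: t).length := by have := hlt i; omega
        have he : (i + 1) % (a :: t).length = 0 := by
          rw [Nat.add_mod, Nat.mod_eq_of_lt (a := 1) (by omega), hi', Nat.mod_self]
        rw [List.getElem_append_right (by omega)] at h
        simp only [he]
        simpa [hi'] using h
  · rw [← hS, List.mem_iff_getElem]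
    constructor
    · rintro ⟨i, hi, rfl⟩
      exact ⟨i, hi, by simp only [Nat.mod_eq_of_lt hi]⟩
    · rintro ⟨i, hi, rfl⟩
      exact ⟨_, hlt i, rfl⟩

namespace IsCyclicEnum

variable {S : Set V} {n : ℕ} {f : ℕ → V}

theorem apply_mem (h : G.IsCyclicEnum S n f) (i : ℕ) : f i ∈ S :=
  (h.mem_iff _).2 ⟨i % n, Nat.mod_lt i h.pos, h.periodic.map_mod_nat i⟩

theorem shift (h : G.IsCyclicEnum S n f) (k : ℕ) : G.IsCyclicEnum S n fun i => f (i + k) where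
  pos := h.pos
  periodic i := by
    change f (i + n + k) = f (i + k)
    rw [add_right_comm, h.periodic]
  adj i := by
    rw [add_right_comm]
    exact h.adj _
  mod_eq i j hij := Nat.ModEq.add_right_cancel' k (h.mod_eq _ _ hij)
  mem_iff x := by
    constructor
    · intro hx
      obtain ⟨i, hi, rfl⟩ := (h.mem_iff x).1 hx
      refine ⟨(i + (n - k % n)) % n, Nat.mod_lt _ h.pos, ?_⟩
      rw [← h.periodic.map_mod_nat (_ + k), ← h.periodic.map_mod_nat i]
      congr 1
      have hk := Nat.mod_lt k h.pos
      have hk' := Nat.mod_add_div k n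
      have : i + (n - k % n) + k = i + n * (k / n + 1) := by
        rw [mul_add]; omega
      rw [Nat.mod_add_mod, this, Nat.add_mul_mod_self_left]
    · rintro ⟨i, -, rfl⟩
      exact h.apply_mem _

theorem eq_of_apply_eq (h : G.IsCyclicEnum S n f) {i j : ℕ} (hij : f i = f j) (h1 : i ≤ j)
    (h2 : j < i + n) : i = j := by
  have h3 : n ∣ j - i := (Nat.modEq_iff_dvd' h1).1 (h.mod_eq i j hij)
  have := Nat.eq_zero_of_dvd_of_lt h3 (by omega)
  omega

theorem connected_induce_Ico (h : G.IsCyclicEnum S n f) {a b : ℕ} (hab : a < b) :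
    (G.induce (f '' Set.Ico a b)).Connected := by
  induction b, hab using Nat.le_induction with
  | base =>
    have : f '' Set.Ico a (a + 1) = {f a} := by
      rw [show Set.Ico a (a + 1) = {a} by ext; simp only [Set.mem_Ico, Set.mem_singleton_iff]; omega,
        Set.image_singleton]
    rw [this]
    exact G.induce_singleton_eq_top (f a) ▸ connected_top
  | succ b hb ih =>
    have : f '' Set.Ico a (b + 1) = f '' Set.Ico a b ∪ {f b} := by
      rw [← Set.image_singleton, ← Set.image_union]
      congr 1
      ext x
      simp only [Set.mem_Ico, Set.mem_union, Set.mem_singleton_iff]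
      omega
    rw [this]
    have hs : (G.induce {f b}).Connected := G.induce_singleton_eq_top (f b) ▸ connected_top
    obtain ⟨b, rfl⟩ : ∃ b', b = b' + 1 := ⟨b - 1, by omega⟩
    exact connected_induce_union ih.preconnected hs.preconnected
      (v := f b) ⟨b, ⟨by omega, by omega⟩, rfl⟩ rfl (h.adj b)

theorem disjoint_Ico (h : G.IsCyclicEnum S n f) {a b c d : ℕ} (hbc : b ≤ c) (hd : d ≤ a + n) :
    Disjoint (f '' Set.Ico a b) (f '' Set.Ico c d) := by
  rw [Set.disjoint_left]
  rintro _ ⟨i, ⟨hi, hi'⟩, rfl⟩ ⟨j, ⟨hj, hj'⟩, hij⟩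
  have := h.eq_of_apply_eq hij.symm (by omega) (by omega)
  omega

theorem not_crossing (h : G.IsCyclicEnum S n f) (hK : ¬ G.HasMinor (completeGraph (Fin 4)))
    {a b c d : ℕ} (hab : a < b) (hbc : b < c) (hcd : c < d) (hd : d < n)
    (hac : G.Adj (f a) (f c)) : ¬ G.Adj (f b) (f d) := by
  intro hbd
  have consec : ∀ {i j k}, i < j → j < k →
      ∃ x ∈ f '' Set.Ico i j, ∃ y ∈ f '' Set.Ico j k, G.Adj x y := by
    intro i j k hij hjk
    obtain ⟨j, rfl⟩ : ∃ j', j = j' + 1 := ⟨j - 1, by omega⟩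
    exact ⟨f j, ⟨j, ⟨by omega, by omega⟩, rfl⟩, f (j + 1), ⟨j + 1, ⟨le_rfl, hjk⟩, rfl⟩, h.adj j⟩
  have hmem : ∀ {i j}, i < j → f i ∈ f '' Set.Ico i j :=
    fun {i j} hij => ⟨i, ⟨le_rfl, hij⟩, rfl⟩
  refine hK (hasMinor_completeGraph_four (A := f '' Set.Ico a b) (B := f '' Set.Ico b c)
    (C := f '' Set.Ico c d) (D := f '' Set.Ico d (a + n))
    (h.connected_induce_Ico hab) (h.connected_induce_Ico hbc) (h.connected_induce_Ico hcd)
    (h.connected_induce_Ico (by omega))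
    (h.disjoint_Ico le_rfl (by omega)) (h.disjoint_Ico (by omega) (by omega))
    (h.disjoint_Ico (by omega) (by omega)) (h.disjoint_Ico le_rfl (by omega))
    (h.disjoint_Ico (by omega) (by omega)) (h.disjoint_Ico le_rfl (by omega))
    (consec hab hbc) ⟨_, hmem hab, _, hmem hcd, hac⟩ ?_ (consec hbc hcd)
    ⟨_, hmem hbc, _, hmem (by omega), hbd⟩ (consec hcd (by omega)))
  refine ⟨f a, hmem hab, f (a + n - 1), ⟨a + n - 1, ⟨by omega, by omega⟩, rfl⟩, ?_⟩
  have := h.adj (a + n - 1)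
  rw [show a + n - 1 + 1 = a + n by omega, h.periodic] at this
  exact this.symm

end IsCyclicEnum

/-- The chords of a noncrossing relation on `{0, …, n - 1}` in which every point other than
`0` and `p` has a third neighbor all straddle `p`. -/
theorem chord_straddles {E : ℕ → ℕ → Prop} {n p : ℕ} (hsymm : ∀ i j, E i j → E j i)
    (hirr : ∀ i, ¬ E i i)
    (hnc : ∀ a b c d, a < b → b < c → c < d → d < n → E a c → ¬ E b d)
    (hdeg : ∀ x, 0 < x → x < n → x ≠ p → ∀ a b, ∃ y < n, E x y ∧ y ≠ a ∧ y ≠ b)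
    {i j : ℕ} (hij : i + 2 ≤ j) (hj : j < n) (h : E i j) : i < p ∧ p < j := by
  induction hd : j - i using Nat.strong_induction_on generalizing i j with
  | _ d ih =>
    by_contra hcon
    have hp : i + 1 ≠ p := by omega
    obtain ⟨y, hyn, hy, hy1, hy2⟩ := hdeg (i + 1) (by omega) (by omega) hp i (i + 2)
    have hy3 : y ≠ i + 1 := fun he => hirr _ (he ▸ hy)
    have hy4 : y ≤ j := by
      by_contra hlt
      exact hnc i (i + 1) j y (by omega) (by omega) (by omega) hyn h hy
    have hy5 : i ≤ y := by
      by_contra hlt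
      exact hnc y i (i + 1) j (by omega) (by omega) (by omega) hj (hsymm _ _ hy) h
    have := ih (y - (i + 1)) (by omega) (i := i + 1) (j := y) (by omega) hyn hy rfl
    omega

/-- Below a chord, every point other than `p` which is not an end is joined to a point of the
interval that is not consecutive to it. -/
theorem exists_chord_below {E : ℕ → ℕ → Prop} {n p : ℕ} (hsymm : ∀ i j, E i j → E j i)
    (hirr : ∀ i, ¬ E i i)
    (hnc : ∀ a b c d, a < b → b < c → c < d → d < n → E a c → ¬ E b d)
    (hdeg : ∀ x, 0 < x → x < n → x ≠ p → ∀ a b, ∃ y < n, E x y ∧ y ≠ a ∧ y ≠ b)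
    {i j : ℕ} (hj : j < n) (h : E i j) {x : ℕ} (hix : i < x) (hxj : x < j) (hxp : x ≠ p) :
    ∃ y, E x y ∧ ((i ≤ y ∧ y + 2 ≤ x ∧ y < p ∧ p < x) ∨ (x + 2 ≤ y ∧ y ≤ j ∧ x < p ∧ p < y)) := by
  obtain ⟨y, hyn, hy, hy1, hy2⟩ := hdeg x (by omega) (by omega) hxp (x - 1) (x + 1)
  have hy3 : y ≠ x := fun he => hirr _ (he ▸ hy)
  refine ⟨y, hy, ?_⟩
  rcases lt_or_gt_of_ne hy3 with hlt | hlt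
  · have hs := chord_straddles hsymm hirr hnc hdeg (i := y) (j := x) (by omega) (by omega)
      (hsymm _ _ hy)
    refine Or.inl ⟨?_, by omega, hs⟩
    by_contra hc
    exact hnc y i x j (by omega) (by omega) (by omega) hj (hsymm _ _ hy) h
  · have hs := chord_straddles hsymm hirr hnc hdeg (i := x) (j := y) (by omega) (by omega) hy
    refine Or.inr ⟨by omega, ?_, hs⟩
    by_contra hc
    exact hnc i x j y (by omega) (by omega) (by omega) hyn h hy

theorem adj_pred_succ_of_chord {E : ℕ → ℕ → Prop} {n p : ℕ} (hsymm : ∀ i j, E i j → E j i)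
    (hirr : ∀ i, ¬ E i i)
    (hnc : ∀ a b c d, a < b → b < c → c < d → d < n → E a c → ¬ E b d)
    (hdeg : ∀ x, 0 < x → x < n → x ≠ p → ∀ a b, ∃ y < n, E x y ∧ y ≠ a ∧ y ≠ b)
    {i j : ℕ} (hij : i + 2 ≤ j) (hj : j < n) (h : E i j) : E (p - 1) (p + 1) := by
  induction hd : j - i using Nat.strong_induction_on generalizing i j with
  | _ d ih =>
    have hp := chord_straddles hsymm hirr hnc hdeg hij hj h
    by_cases h1 : i + 1 = p
    · by_cases h2 : j = p + 1
      · have h3 : i = p - 1 := by omega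
        rwa [h3, h2] at h
      · obtain ⟨y, hy, hy' | hy'⟩ := exists_chord_below hsymm hirr hnc hdeg hj h (x := j - 1)
          (by omega) (by omega) (by omega)
        · exact ih (j - 1 - y) (by omega) (by omega) (by omega) (hsymm _ _ hy) rfl
        · omega
    · obtain ⟨y, hy, hy' | hy'⟩ := exists_chord_below hsymm hirr hnc hdeg hj h (x := i + 1)
        (by omega) (by omega) h1
      · omega
      · exact ih (y - (i + 1)) (by omega) (by omega) (by omega) hy rfl

theorem exists_next_rung_colors : ∀ α β γ : Fin 3, α ≠ β →
    ∃ α' β', α' ≠ β' ∧ α ≠ α' ∧ β' ≠ β ∧ γ ≠ α' ∧ γ ≠ β' := by decide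

/-- If all triangles below the chord `i j` contain `p`, then the points below this chord form a
ladder closed off by a triangle at `p`, which can be colored with prescribed colors at `i`, `j`
and `p`. -/
theorem exists_coloring_below_chord {E : ℕ → ℕ → Prop} {n p : ℕ}
    (hsymm : ∀ i j, E i j → E j i) (hirr : ∀ i, ¬ E i i) (hpath : ∀ i, E i (i + 1))
    (hnc : ∀ a b c d, a < b → b < c → c < d → d < n → E a c → ¬ E b d)
    (hdeg : ∀ x, 0 < x → x < n → x ≠ p → ∀ a b, ∃ y < n, E x y ∧ y ≠ a ∧ y ≠ b)
    (htri : ∀ x y z, 0 < x → x < y → y < z → z < n → E x y → E y z → E x z →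
      x = p ∨ y = p ∨ z = p)
    {i j : ℕ} (hi : 0 < i) (hij : i + 2 ≤ j) (hj : j < n) (h : E i j) {α β γ : Fin 3} (hαβ : α ≠ β)
    (hγ : j = i + 2 → γ ≠ α ∧ γ ≠ β) :
    ∃ g : ℕ → Fin 3, (∀ x y, i ≤ x → x < y → y ≤ j → E x y → g x ≠ g y) ∧
      g i = α ∧ g j = β ∧ g p = γ := by
  induction hd : j - i using Nat.strong_induction_on generalizing i j α β with
  | _ d ih =>
    have hp := chord_straddles hsymm hirr hnc hdeg hij hj h
    by_cases hj2 : j = i + 2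
    · obtain ⟨h1, h2⟩ := hγ hj2
      refine ⟨fun x => if x = i then α else if x = p then γ else β, ?_, ?_, ?_, ?_⟩
      · intro x y hx hxy hy _
        obtain ⟨rfl, rfl⟩ | ⟨rfl, rfl⟩ | ⟨rfl, rfl⟩ :
            (x = i ∧ y = p) ∨ (x = i ∧ y = j) ∨ (x = p ∧ y = j) := by omega
        · simpa [hxy.ne'] using h1.symm
        · simpa [hxy.ne', hp.2.ne'] using hαβ
        · simpa [hp.1.ne', hxy.ne', (hp.1.trans hp.2).ne'] using h2
      · simp
      · simp [hp.2.ne', (hp.1.trans hp.2).ne']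
      · simp [hp.1.ne']
    · have hpred : E (j - 1) j := by
        have := hpath (j - 1)
        rwa [Nat.sub_add_cancel (by omega)] at this
      have no_right : E i (j - 1) → j - 1 = p := fun he => by
        have := htri i (j - 1) j hi (by omega) (by omega) hj he hpred h
        omega
      have no_left : E (i + 1) j → i + 1 = p := fun he => by
        have := htri i (i + 1) j hi (by omega) (by omega) hj (hpath i) he h
        omega
      have hi1 : i + 1 ≠ p := fun he => by
        obtain ⟨y, hy, hy' | hy'⟩ := exists_chord_below hsymm hirr hnc hdeg hj h (x := j - 1)
          (by omega) (by omega) (by omega)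
        · obtain rfl : y = i := by omega
          have := no_right (hsymm _ _ hy)
          omega
        · omega
      have hj1 : j - 1 ≠ p := fun he => by
        obtain ⟨y, hy, hy' | hy'⟩ := exists_chord_below hsymm hirr hnc hdeg hj h (x := i + 1)
          (by omega) (by omega) (by omega)
        · omega
        · obtain rfl : y = j := by omega
          have := no_left hy
          omega
      have hrung : E (i + 1) (j - 1) := by
        obtain ⟨y, hy, hy' | hy'⟩ := exists_chord_below hsymm hirr hnc hdeg hj h (x := i + 1)
          (by omega) (by omega) hi1
        · omega
        obtain ⟨z, hz, hz' | hz'⟩ := exists_chord_below hsymm hirr hnc hdeg hj h (x := j - 1)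
          (by omega) (by omega) hj1
        · have hyj : y ≠ j := fun he => hi1 (no_left (he ▸ hy))
          have hzi : z ≠ i := fun he => hj1 (no_right (he ▸ hsymm _ _ hz))
          by_cases hyj1 : y = j - 1
          · rwa [← hyj1]
          · by_cases hzi1 : z = i + 1
            · rw [← hzi1]; exact hsymm _ _ hz
            · exact absurd (hsymm _ _ hz)
                (hnc (i + 1) z y (j - 1) (by omega) (by omega) (by omega) (by omega) hy)
        · omega
      obtain ⟨α', β', h1, h2, h3, h4, h5⟩ := exists_next_rung_colors α β γ hαβ
      obtain ⟨g, hg, hgi, hgj, hgp⟩ := ih (j - 1 - (i + 1)) (by omega) (i := i + 1) (j := j - 1)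
        (by omega) (by omega) (by omega) hrung h1 (fun _ => ⟨h4, h5⟩) rfl
      have hji : j ≠ i := by omega
      have hpi : p ≠ i := by omega
      have hpj : p ≠ j := by omega
      refine ⟨fun x => if x = i then α else if x = j then β else g x, ?_, ?_, ?_, ?_⟩
      · intro x y hx hxy hy hE
        by_cases hxi : x = i
        · subst hxi
          by_cases hyj : y = j
          · subst hyj
            simpa [hji] using hαβ
          · have hy1 : y = x + 1 := by
              by_contra hne
              by_cases hyj' : y = j - 1
              · exact hj1 (no_right (hyj' ▸ hE))
              · exact hnc x (x + 1) y (j - 1) (by omega) (by omega) (by omega) (by omega) hE hrung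
            simp only [if_true, if_neg hxy.ne', if_neg hyj]
            rw [hy1, hgi]; exact h2
        · by_cases hyj : y = j
          · subst hyj
            have hx1 : x = y - 1 := by
              by_contra hne
              by_cases hxi' : x = i + 1
              · exact hi1 (no_left (hxi' ▸ hE))
              · exact hnc (i + 1) x (y - 1) y (by omega) (by omega) (by omega) (by omega) hrung hE
            simp only [if_true, if_neg hxi, if_neg hxy.ne, if_neg hji]
            rw [hx1, hgj]; exact h3
          · have hyi : y ≠ i := by omega
            have hxj : x ≠ j := by omega
            simp only [if_neg hxi, if_neg hyi, if_neg hxj, if_neg hyj]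
            exact hg x y (by omega) hxy (by omega) hE
      · simp
      · simp [hji]
      · simpa [hpi, hpj] using hgp

namespace IsCyclicEnum

variable {S : Set V} {n : ℕ} {f : ℕ → V}

theorem injOn (h : G.IsCyclicEnum S n f) : Set.InjOn f (Set.Iio n) := by
  intro i hi j hj hij
  have := h.mod_eq i j hij
  rwa [Nat.mod_eq_of_lt hi, Nat.mod_eq_of_lt hj] at this

theorem adj_zero_pred (h : G.IsCyclicEnum S n f) : G.Adj (f 0) (f (n - 1)) := by
  have h1 := h.adj (n - 1)
  have h2 := h.periodic 0
  rw [Nat.sub_add_cancel h.pos, ← zero_add n, h2] at h1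
  simpa using h1.symm

theorem exists_third_neighbor_index (h : G.IsCyclicEnum S n f) {p : ℕ} (hp : p < n)
    (hdeg : ∀ x ∈ S, x ≠ f 0 → x ≠ f p → ∀ a b, ∃ y ∈ S, G.Adj x y ∧ y ≠ a ∧ y ≠ b)
    (x : ℕ) (hx0 : 0 < x) (hxn : x < n) (hxp : x ≠ p) (a b : ℕ) :
    ∃ y < n, G.Adj (f x) (f y) ∧ y ≠ a ∧ y ≠ b := by
  obtain ⟨y, hy, hxy, hya, hyb⟩ := hdeg (f x) (h.apply_mem x)
    (fun he => hx0.ne' (h.injOn hxn h.pos he)) (fun he => hxp (h.injOn hxn hp he)) (f a) (f b)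
  obtain ⟨k, hk, rfl⟩ := (h.mem_iff y).1 hy
  exact ⟨k, hk, hxy, fun he => hya (he ▸ rfl), fun he => hyb (he ▸ rfl)⟩

theorem exists_ear (h : G.IsCyclicEnum S n f) (hK : ¬ G.HasMinor (completeGraph (Fin 4)))
    {v : V} (hv : v ∈ S) (huv : f 0 ≠ v) (hadj : ¬ G.Adj (f 0) v)
    (hdeg : ∀ x ∈ S, x ≠ f 0 → x ≠ v → ∀ a b, ∃ y ∈ S, G.Adj x y ∧ y ≠ a ∧ y ≠ b) :
    ∃ p, 2 ≤ p ∧ p + 2 ≤ n ∧ f p = v ∧ G.Adj (f (p - 1)) (f (p + 1)) := by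
  obtain ⟨p, hp, rfl⟩ := (h.mem_iff v).1 hv
  have h0 : p ≠ 0 := fun he => huv (he ▸ rfl)
  have h1 : p ≠ 1 := fun he => hadj (he ▸ h.adj 0)
  have h2 : p ≠ n - 1 := fun he => hadj (he ▸ h.adj_zero_pred)
  refine ⟨p, by omega, by omega, rfl, ?_⟩
  exact adj_pred_succ_of_chord (E := fun i j => G.Adj (f i) (f j)) (n := n)
    (fun i j hij => hij.symm) (fun i => G.loopless.irrefl _)
    (fun a b c d hab hbc hcd hd => h.not_crossing hK hab hbc hcd hd)
    (h.exists_third_neighbor_index hp hdeg) (i := 0) (j := n - 1) (by omega) (by omega)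
    h.adj_zero_pred

theorem exists_two_ears (h : G.IsCyclicEnum S n f) (hK : ¬ G.HasMinor (completeGraph (Fin 4)))
    {v : V} (hv : v ∈ S) (huv : f 0 ≠ v) (hadj : ¬ G.Adj (f 0) v)
    (hdeg : ∀ x ∈ S, x ≠ f 0 → x ≠ v → ∀ a b, ∃ y ∈ S, G.Adj x y ∧ y ≠ a ∧ y ≠ b) :
    ∃ p, 2 ≤ p ∧ p + 2 ≤ n ∧ f p = v ∧ G.Adj (f (p - 1)) (f (p + 1)) ∧
      G.Adj (f 1) (f (n - 1)) := by
  obtain ⟨p, hp2, hpn, rfl, hp⟩ := h.exists_ear hK hv huv hadj hdeg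
  obtain ⟨q, hq2, hqn, hq0, hq⟩ := (h.shift p).exists_ear hK (h.apply_mem 0)
    (by simpa using huv.symm) (by simpa using fun he => hadj he.symm)
    (by simpa using fun x hx hxp hx0 => hdeg x hx hx0 hxp)
  have hqp : q + p = n := by
    obtain ⟨k, hk⟩ : n ∣ q + p := by
      have := h.mod_eq _ _ hq0
      rw [Nat.zero_mod] at this
      exact Nat.dvd_of_mod_eq_zero this
    have h1 : k < 2 := by
      by_contra hk2
      have := Nat.mul_le_mul_left n (not_lt.1 hk2)
      omega
    interval_cases k <;> omega
  refine ⟨p, hp2, hpn, rfl, hp, ?_⟩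
  have h1 : q - 1 + p = n - 1 := by omega
  have h2 : q + 1 + p = 1 + n := by omega
  rw [h1, h2, h.periodic] at hq
  exact hq.symm

end IsCyclicEnum

theorem exists_two_colors_ne : ∀ c : Fin 3, ∃ α β, α ≠ β ∧ c ≠ α ∧ c ≠ β := by decide

theorem IsCyclicEnum.exists_properOn [Fintype V] {S : Set V} {n : ℕ} {f : ℕ → V}
    (h : G.IsCyclicEnum S n f) (hK : ¬ G.HasMinor (completeGraph (Fin 4)))
    (htri : {t : Finset V | G.IsNClique 3 t}.ncard ≤ 2)
    (hd : ¬ ∃ f : Fin 4 → V, IsDiamondCopy G f)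
    {v : V} (hv : v ∈ S) (huv : f 0 ≠ v) (hadj : ¬ G.Adj (f 0) v)
    (hdeg : ∀ x ∈ S, x ≠ f 0 → x ≠ v → ∀ a b, ∃ y ∈ S, G.Adj x y ∧ y ≠ a ∧ y ≠ b)
    (c₁ c₂ : Fin 3) : ∃ c, G.ProperOn S c ∧ c (f 0) = c₁ ∧ c v = c₂ := by
  classical
  obtain ⟨p, hp2, hpn, rfl, hp, h1n⟩ := h.exists_two_ears hK hv huv hadj hdeg
  have hne : ∀ {i j}, i < n → j < n → i ≠ j → f i ≠ f j :=
    fun hi hj hij he => hij (h.injOn hi hj he)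
  have hpred : G.Adj (f (p - 1)) (f p) := by
    have := h.adj (p - 1)
    rwa [Nat.sub_add_cancel (by omega)] at this
  have hn : 5 ≤ n := by
    by_contra hlt
    obtain rfl : n = 4 := by omega
    obtain rfl : p = 2 := by omega
    refine hd ⟨![f 0, f 2, f 1, f 3], ?_, ?_⟩
    · intro i j hij
      fin_cases i <;> fin_cases j <;> simp at hij ⊢ <;>
        exact hne (by omega) (by omega) (by omega) hij
    · have e01 := h.adj 0
      have e12 := h.adj 1
      have e23 := h.adj 2
      have e03 := h.adj_zero_pred
      intro i j hij
      fin_cases i <;> fin_cases j <;> simp [diamondGraph] at hij ⊢ <;>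
        first | assumption | (apply SimpleGraph.Adj.symm; assumption)
  have htri' : ∀ x y z, 0 < x → x < y → y < z → z < n → G.Adj (f x) (f y) → G.Adj (f y) (f z) →
      G.Adj (f x) (f z) → x = p ∨ y = p ∨ z = p := by
    intro x y z hx hxy hyz hz exy eyz exz
    by_contra! hcon
    have t1 : G.IsNClique 3 {f x, f y, f z} := is3Clique_triple_iff.2 ⟨exy, exz, eyz⟩
    have t2 : G.IsNClique 3 {f 0, f 1, f (n - 1)} :=
      is3Clique_triple_iff.2 ⟨h.adj 0, h.adj_zero_pred, h1n⟩
    have t3 : G.IsNClique 3 {f (p - 1), f p, f (p + 1)} :=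
      is3Clique_triple_iff.2 ⟨hpred, hp, h.adj p⟩
    have d0 : f 0 ∉ ({f x, f y, f z} : Finset V) := by
      simp only [Finset.mem_insert, Finset.mem_singleton, not_or]
      refine ⟨hne ?_ ?_ ?_, hne ?_ ?_ ?_, hne ?_ ?_ ?_⟩ <;> omega
    have dp : f p ∉ ({f x, f y, f z} : Finset V) := by
      simp only [Finset.mem_insert, Finset.mem_singleton, not_or]
      refine ⟨hne ?_ ?_ ?_, hne ?_ ?_ ?_, hne ?_ ?_ ?_⟩ <;> omega
    have dp' : f p ∉ ({f 0, f 1, f (n - 1)} : Finset V) := by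
      simp only [Finset.mem_insert, Finset.mem_singleton, not_or]
      refine ⟨hne ?_ ?_ ?_, hne ?_ ?_ ?_, hne ?_ ?_ ?_⟩ <;> omega
    have hlt : 2 < {t : Finset V | G.IsNClique 3 t}.ncard :=
      (Set.two_lt_ncard (Set.toFinite _)).2 ⟨_, t1, _, t2, _, t3,
        fun he => d0 (he ▸ by simp), fun he => dp (he ▸ by simp), fun he => dp' (he ▸ by simp)⟩
    omega
  obtain ⟨α, β, hαβ, hα, hβ⟩ := exists_two_colors_ne c₁
  obtain ⟨g, hg, hg1, hgn, hgp⟩ := exists_coloring_below_chord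
    (E := fun i j => G.Adj (f i) (f j)) (n := n) (p := p)
    (fun i j hij => hij.symm) (fun i => G.loopless.irrefl _) h.adj
    (fun a b c d hab hbc hcd hd => h.not_crossing hK hab hbc hcd hd)
    (h.exists_third_neighbor_index (by omega) hdeg) htri' (i := 1) (j := n - 1)
    one_pos (by omega) (by omega) h1n (γ := c₂) hαβ (by omega)
  let c : V → Fin 3 := fun x =>
    let k := Function.invFunOn f (Set.Iio n) x
    if k = 0 then c₁ else g k
  have hc : ∀ i < n, c (f i) = if i = 0 then c₁ else g i := by
    intro i hi
    simp only [c, h.injOn.leftInvOn_invFunOn (show i ∈ Set.Iio n from hi)]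
  have key : ∀ i j, i < j → j < n → G.Adj (f i) (f j) → c (f i) ≠ c (f j) := by
    intro i j hij hj he
    rw [hc i (by omega), hc j hj, if_neg (by omega : j ≠ 0)]
    by_cases hi : i = 0
    · subst hi
      rw [if_pos rfl]
      by_cases hj1 : j = 1
      · rwa [hj1, hg1]
      by_cases hjn : j = n - 1
      · rwa [hjn, hgn]
      exact absurd h1n (h.not_crossing hK (by omega) (by omega) (by omega) (by omega) he)
    · rw [if_neg hi]
      exact hg i j (by omega) hij (by omega) he
  refine ⟨c, fun x hx y hy hxy => ?_, ?_, ?_⟩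
  · obtain ⟨i, hi, rfl⟩ := (h.mem_iff x).1 hx
    obtain ⟨j, hj, rfl⟩ := (h.mem_iff y).1 hy
    rcases lt_trichotomy i j with hij | rfl | hij
    · exact key i j hij hj hxy
    · exact absurd rfl hxy.ne
    · exact (key j i hij hi hxy.symm).symm
  · rw [hc 0 (by omega), if_pos rfl]
  · rw [hc p (by omega), if_neg (by omega), hgp]

theorem Outerplanar.pairExtendable [Fintype V] (hout : G.Outerplanar)
    (htri : {t : Finset V | G.IsNClique 3 t}.ncard ≤ 2)
    (hd : ¬ ∃ f : Fin 4 → V, IsDiamondCopy G f) (S : Set V) : G.PairExtendable S := by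
  classical
  induction S using WellFoundedLT.induction with
  | _ S ih =>
    intro u hu v hv huv hadj c₁ c₂
    by_contra hno
    obtain ⟨a, ha, b, hb, hab⟩ : ∃ a ∈ S, ∃ b ∈ S, G.Adj a b := by
      by_contra! hcon
      exact hno ⟨fun x => if x = u then c₁ else c₂, fun x hx y hy hxy => absurd hxy (hcon x hx y hy),
        by simp, by simp [huv.symm]⟩
    obtain ⟨l, hl, hlS⟩ := exists_isCyclicList_of_no_separation hout.2 (S := S) (by
      intro A B hS hA hB hsub
      by_contra! hcross
      refine hno (PairExtendable.of_separation hd hS (ih A ?_) (ih B ?_) hsub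
        hcross u hu v hv huv hadj c₁ c₂)
      · exact lt_of_le_of_ne (hS ▸ Set.subset_union_left) hA
      · exact lt_of_le_of_ne (hS ▸ Set.subset_union_right) hB) ha hb hab
    obtain ⟨n, f, hf⟩ := hl.exists_isCyclicEnum hlS
    obtain ⟨k, -, rfl⟩ := (hf.mem_iff u).1 hu
    have hf' := hf.shift k
    have h0 : f (0 + k) = f k := by rw [zero_add]
    obtain ⟨c, hc, hcu, hcv⟩ := hf'.exists_properOn hout.1 htri hd hv (by rwa [h0]) (by rwa [h0])
      (by
        rw [h0]
        intro x hx hxu hxv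
        exact exists_third_neighbor hno
          (ih (S \ {x}) (Set.sdiff_singleton_ssubset.2 hx) _ ⟨hu, hxu.symm⟩ v ⟨hv, hxv.symm⟩
            huv hadj c₁ c₂) hxu hxv) c₁ c₂
    exact hno ⟨c, hc, h0 ▸ hcu, hcv⟩

end SimpleGraph

theorem precoloring_two_independent_two_triangles_no_diamond_connected
    {V : Type*} [Fintype V] (G : SimpleGraph V)
    (hout : G.Outerplanar) (hconn : G.Connected)
    (htri : {t : Finset V | G.IsNClique 3 t}.ncard = 2)
    (hnodiamond : ¬ ∃ f : Fin 4 → V, IsDiamondCopy G f)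
    (u v : V) (huv : u ≠ v) (hadj : ¬ G.Adj u v)
    (c₁ c₂ : Fin 3) :
    ∃ c : G.Coloring (Fin 3), c u = c₁ ∧ c v = c₂ := by
  obtain ⟨c, hc, hu, hv⟩ := hout.pairExtendable htri.le hnodiamond Set.univ
    u trivial v trivial huv hadj c₁ c₂
  exact ⟨SimpleGraph.Coloring.mk c fun {x y} hxy => hc x trivial y trivial hxy, hu, hv⟩
end

section
/- Let G be a finite simple connected outerplanar graph containing exactly two triangles, which contains a diamond D (a subgraph isomorphic to K₄ minus one edge), and let u, v be the two diamond vertices of D (the two nonadjacent vertices of D). Then every assignment of the same color from a 3-element color set to both u and v extends to a proper 3-coloring of G. -/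
theorem List.exists_reverse_cons_cons {α : Type*} (a b : α) (l : List α) :
    ∃ c d q, (a :: b :: l).reverse = c :: d :: q ∧ q.length = l.length ∧ a ∈ d :: q := by
  rcases hl : (b :: l).reverse with _ | ⟨c, q⟩
  · simp at hl
  have hlen : q.length = l.length := by simpa using (congrArg List.length hl).symm
  rw [List.reverse_cons, hl]
  rcases q with _ | ⟨d, q⟩
  · exact ⟨c, a, [], by simpa using hlen⟩
  · exact ⟨c, d, q ++ [a], by simpa using hlen⟩

section

variable {V : Type*} {G : SimpleGraph V}

/-- The vertices of a nonempty walk, given as a list, induce a connected subgraph. -/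
theorem SimpleGraph.induce_connected_of_isChain :
    ∀ {l : List V}, l ≠ [] → l.IsChain G.Adj → (G.induce {x | x ∈ l}).Connected
  | [], h, _ => absurd rfl h
  | [a], _, _ => by
    have : {x | x ∈ [a]} = ({a} : Set V) := by ext; simp
    rw [this]
    exact SimpleGraph.Connected.of_subsingleton
  | a :: b :: l, _, h => by
    rw [List.isChain_cons_cons] at h
    have hl := SimpleGraph.induce_connected_of_isChain (List.cons_ne_nil b l) h.2
    have : {x | x ∈ a :: b :: l} = ({a} : Set V) ∪ {x | x ∈ b :: l} := by ext; simp
    rw [this]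
    exact SimpleGraph.connected_induce_union
      .of_subsingleton hl.preconnected
      (Set.mem_singleton a) (by simp) h.1

/-- `l` lists the vertices of a path inside `s`, and no path inside `s` is longer. -/
structure SimpleGraph.IsLongestPathIn (G : SimpleGraph V) (s : Finset V) (l : List V) : Prop where
  isChain : l.IsChain G.Adj
  nodup : l.Nodup
  subset : ∀ x ∈ l, x ∈ s
  length_le : ∀ l' : List V, l'.IsChain G.Adj → l'.Nodup → (∀ x ∈ l', x ∈ s) →
    l'.length ≤ l.length

namespace SimpleGraph.IsLongestPathIn

variable {s : Finset V}

theorem mem_of_adj_head {a b : V} {l : List V} (h : G.IsLongestPathIn s (a :: l))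
    (hb : b ∈ s) (hab : G.Adj a b) : b ∈ l := by
  by_contra hbl
  have := h.length_le (b :: a :: l) (List.isChain_cons_cons.2 ⟨hab.symm, h.isChain⟩)
    (List.nodup_cons.2 ⟨by simp [hab.ne', hbl], h.nodup⟩)
    (by simpa [hb] using h.subset)
  simp at this

/-- Pósa rotation: reversing the part of a longest path before a neighbour of its first vertex. -/
theorem rotate {a z : V} {l r : List V} (h : G.IsLongestPathIn s (a :: l ++ z :: r))
    (haz : G.Adj a z) : G.IsLongestPathIn s ((a :: l).reverse ++ z :: r) where
  isChain := by
    have h₁ := List.isChain_append.1 h.isChain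
    refine List.isChain_append.2 ⟨?_, h₁.2.1, by simpa using haz⟩
    rw [List.isChain_reverse]
    exact h₁.1.imp fun _ _ h => h.symm
  nodup := (((List.reverse_perm (a :: l)).append_right (z :: r)).nodup_iff).2 h.nodup
  subset x hx := h.subset x (by simpa [or_comm, or_assoc, or_left_comm] using hx)
  length_le l' h₁ h₂ h₃ := by simpa [add_assoc] using h.length_le l' h₁ h₂ h₃

theorem hasMinor_of_chords (hdeg : ∀ v ∈ s, ∀ a b, ∃ w ∈ s, G.Adj v w ∧ w ≠ a ∧ w ≠ b)
    {a b z : V} {l r : List V} (h : G.IsLongestPathIn s (a :: b :: l ++ z :: r))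
    (haz : G.Adj a z) (hchord : ∃ x ∈ b :: l, ∃ y ∈ r, G.Adj x y) :
    G.HasMinor (completeGraph (Fin 4)) := by
  obtain ⟨w, hws, haw, hwb, hwz⟩ := hdeg a (h.subset a (by simp)) b z
  have hw : w ∈ l ∨ w ∈ r := by
    have := h.mem_of_adj_head hws haw
    simpa [hwb, hwz] using this
  rcases hw with hw | hw
  · obtain ⟨l₁, l₂, rfl⟩ := List.append_of_mem hw
    have h' : G.IsLongestPathIn s (a :: (b :: l₁) ++ w :: (l₂ ++ z :: r)) := by
      simpa using h
    have hrot := h'.rotate haw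
    have hlast := (List.isChain_append.1 h'.isChain).2.2
    obtain ⟨c, d, q, hq, hqlen, haq⟩ := List.exists_reverse_cons_cons a b l₁
    rw [← List.head?_reverse, hq] at hlast
    rw [hq] at hrot
    have hterm : q.length < (l₁ ++ w :: l₂).length := by
      rw [hqlen, List.length_append, List.length_cons]
      omega
    exact hasMinor_of_chords hdeg hrot (hlast c (by simp) w (by simp)) ⟨a, haq, z, by simp, haz⟩
  · obtain ⟨x, hx, y, hy, hxy⟩ := hchord
    obtain ⟨hL, hR, hLR⟩ := List.isChain_append.1 h.isChain
    have hnd := h.nodup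
    have hbl : (b :: l).IsChain G.Adj := hL.tail
    have hr : r.IsChain G.Adj := hR.tail
    have hrne : r ≠ [] := List.ne_nil_of_mem hw
    obtain ⟨t, ht, htz⟩ : ∃ t ∈ b :: l, G.Adj t z :=
      ⟨(b :: l).getLast (by simp), List.getLast_mem _,
        hLR _ (by simp [List.getLast?_eq_some_getLast]) _ (by simp)⟩
    obtain ⟨u, hu, hzu⟩ : ∃ u ∈ r, G.Adj z u := by
      obtain ⟨u, r', rfl⟩ := List.exists_cons_of_ne_nil hrne
      exact ⟨u, by simp, (List.isChain_cons_cons.1 hR).1⟩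
    have hab : G.Adj a b := (List.isChain_cons_cons.1 hL).1
    refine ⟨![{a}, {x | x ∈ b :: l}, {z}, {x | x ∈ r}], ?_, ?_, ?_⟩
    · intro i
      fin_cases i
      · exact SimpleGraph.Connected.of_subsingleton (V := ({a} : Set V))
      · exact SimpleGraph.induce_connected_of_isChain (by simp) hbl
      · exact SimpleGraph.Connected.of_subsingleton (V := ({z} : Set V))
      · exact SimpleGraph.induce_connected_of_isChain hrne hr
    · rw [List.nodup_append, List.nodup_cons] at hnd
      obtain ⟨⟨ha, -⟩, hzr, hdisj⟩ := hnd
      have d01 : Disjoint {a} {x | x ∈ b :: l} := by simpa using ha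
      have d02 : Disjoint ({a} : Set V) {z} := by simpa using haz.ne
      have d03 : Disjoint {a} {x | x ∈ r} := by
        simpa using fun har => hdisj a (by simp) a (by simp [har]) rfl
      have d12 : Disjoint {x | x ∈ b :: l} {z} := by
        rw [Set.disjoint_singleton_right]
        exact fun hzl => hdisj z (List.mem_cons_of_mem _ hzl) z (by simp) rfl
      have d13 : Disjoint {x | x ∈ b :: l} {x | x ∈ r} := Set.disjoint_left.2 fun x hx hx' =>
        hdisj x (List.mem_cons_of_mem _ hx) x (List.mem_cons_of_mem _ hx') rfl
      have d23 : Disjoint {z} {x | x ∈ r} := by simpa using (List.nodup_cons.1 hzr).1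
      intro i j hij
      fin_cases i <;> fin_cases j <;> first
        | exact absurd rfl hij | assumption | (apply Disjoint.symm; assumption)
    · have e01 : ∃ p ∈ ({a} : Set V), ∃ q ∈ {x | x ∈ b :: l}, G.Adj p q :=
        ⟨a, rfl, b, by simp, hab⟩
      have e02 : ∃ p ∈ ({a} : Set V), ∃ q ∈ ({z} : Set V), G.Adj p q := ⟨a, rfl, z, rfl, haz⟩
      have e03 : ∃ p ∈ ({a} : Set V), ∃ q ∈ {x | x ∈ r}, G.Adj p q := ⟨a, rfl, w, hw, haw⟩
      have e12 : ∃ p ∈ {x | x ∈ b :: l}, ∃ q ∈ ({z} : Set V), G.Adj p q := ⟨t, ht, z, rfl, htz⟩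
      have e13 : ∃ p ∈ {x | x ∈ b :: l}, ∃ q ∈ {x | x ∈ r}, G.Adj p q := ⟨x, hx, y, hy, hxy⟩
      have e23 : ∃ p ∈ ({z} : Set V), ∃ q ∈ {x | x ∈ r}, G.Adj p q := ⟨z, rfl, u, hu, hzu⟩
      have swap {A B : Set V} (h : ∃ p ∈ A, ∃ q ∈ B, G.Adj p q) :
          ∃ p ∈ B, ∃ q ∈ A, G.Adj p q :=
        let ⟨p, hp, q, hq, hpq⟩ := h
        ⟨q, hq, p, hp, hpq.symm⟩
      intro i j hij
      fin_cases i <;> fin_cases j <;> first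
        | exact absurd rfl hij.ne | assumption | (apply swap; assumption)
termination_by l.length

end SimpleGraph.IsLongestPathIn

theorem SimpleGraph.exists_isLongestPathIn (G : SimpleGraph V) (s : Finset V) :
    ∃ l, G.IsLongestPathIn s l := by
  classical
  let P : ℕ → Prop := fun n =>
    ∃ l : List V, (l.IsChain G.Adj ∧ l.Nodup ∧ ∀ x ∈ l, x ∈ s) ∧ l.length = n
  have hbound : ∀ l : List V, l.Nodup → (∀ x ∈ l, x ∈ s) → l.length ≤ s.card := fun l hl hs => by
    rw [← List.toFinset_card_of_nodup hl]
    exact Finset.card_le_card fun x hx => hs x (by simpa using hx)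
  have h0 : P 0 := ⟨[], by simp⟩
  obtain ⟨l, ⟨h₁, h₂, h₃⟩, hl⟩ := Nat.findGreatest_spec (Nat.zero_le s.card) h0
  refine ⟨l, h₁, h₂, h₃, fun l' h₁' h₂' h₃' => ?_⟩
  rw [hl]
  exact Nat.le_findGreatest (hbound l' h₂' h₃') ⟨l', ⟨h₁', h₂', h₃'⟩, rfl⟩

/-- If every vertex of a nonempty finite set `s` has three neighbours in `s`, then there is a
`K₄` minor. -/
theorem SimpleGraph.hasMinor_completeGraph_four_of_three_neighbors {s : Finset V}
    (hs : s.Nonempty) (hdeg : ∀ v ∈ s, ∀ a b, ∃ w ∈ s, G.Adj v w ∧ w ≠ a ∧ w ≠ b) :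
    G.HasMinor (completeGraph (Fin 4)) := by
  obtain ⟨p, hp⟩ := G.exists_isLongestPathIn s
  obtain ⟨v, hv⟩ := hs
  rcases p with _ | ⟨a, p⟩
  · simpa using hp.length_le [v] (by simp) (by simp) (by simpa using hv)
  have ha : a ∈ s := hp.subset a (by simp)
  rcases p with _ | ⟨b, p⟩
  · obtain ⟨w, hws, haw, -⟩ := hdeg a ha a a
    simpa using hp.mem_of_adj_head hws haw
  have key : ∀ l₁ z l₂ w, p = l₁ ++ z :: l₂ → w ∈ l₂ → G.Adj a z → G.Adj a w →
      G.HasMinor (completeGraph (Fin 4)) := by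
    rintro l₁ z l₂ w rfl hw haz haw
    have h' : G.IsLongestPathIn s (a :: (b :: l₁) ++ z :: l₂) := by simpa using hp
    have hrot := h'.rotate haz
    have hlast := (List.isChain_append.1 h'.isChain).2.2
    obtain ⟨c, d, q, hq, hqlen, haq⟩ := List.exists_reverse_cons_cons a b l₁
    rw [← List.head?_reverse, hq] at hlast
    rw [hq] at hrot
    exact hrot.hasMinor_of_chords hdeg (hlast c (by simp) z (by simp)) ⟨a, haq, w, hw, haw⟩
  obtain ⟨x, hxs, hax, hxb, -⟩ := hdeg a ha b b
  obtain ⟨y, hys, hay, hyb, hyx⟩ := hdeg a ha b x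
  have hx : x ∈ p := by simpa [hxb] using hp.mem_of_adj_head hxs hax
  have hy : y ∈ p := by simpa [hyb] using hp.mem_of_adj_head hys hay
  obtain ⟨l₁, l₂, rfl⟩ := List.append_of_mem hx
  rcases List.mem_append.1 hy with hy | hy
  · obtain ⟨l₃, l₄, rfl⟩ := List.append_of_mem hy
    exact key l₃ y (l₄ ++ x :: l₂) x (by simp) (by simp) hay hax
  · exact key l₁ x l₂ y rfl (by simpa [hyx] using hy) hax hay

/-- Finite graphs without a `K₄` minor are 3-colorable. -/
theorem SimpleGraph.colorable_three_of_not_hasMinor [Finite V]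
    (hG : ¬ G.HasMinor (completeGraph (Fin 4))) : G.Colorable 3 := by
  classical
  have := Fintype.ofFinite V
  have key : ∀ s : Finset V, ∃ c : V → Fin 3, ∀ x ∈ s, ∀ y ∈ s, G.Adj x y → c x ≠ c y := by
    intro s
    induction s using Finset.strongInduction with
    | H s ih =>
      rcases s.eq_empty_or_nonempty with rfl | hs
      · exact ⟨fun _ => 0, by simp⟩
      have hdeg : ¬ ∀ v ∈ s, ∀ a b, ∃ w ∈ s, G.Adj v w ∧ w ≠ a ∧ w ≠ b :=
        fun h => hG (SimpleGraph.hasMinor_completeGraph_four_of_three_neighbors hs h)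
      push Not at hdeg
      obtain ⟨v, hv, a, b, hab⟩ := hdeg
      obtain ⟨c, hc⟩ := ih (s.erase v) (Finset.erase_ssubset hv)
      obtain ⟨k, hka, hkb⟩ : ∃ k : Fin 3, k ≠ c a ∧ k ≠ c b :=
        (by decide : ∀ i j : Fin 3, ∃ k, k ≠ i ∧ k ≠ j) (c a) (c b)
      have hk : ∀ w ∈ s, G.Adj v w → k ≠ c w := fun w hw hvw => by
        by_cases hwa : w = a
        · exact hwa ▸ hka
        · exact hab w hw hvw hwa ▸ hkb
      refine ⟨Function.update c v k, fun x hx y hy hxy => ?_⟩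
      by_cases hxv : x = v
      · subst hxv
        simpa [hxy.ne'] using hk y hy hxy
      by_cases hyv : y = v
      · subst hyv
        simpa [hxy.ne] using (hk x hx hxy.symm).symm
      · simpa [hxv, hyv] using
          hc x (Finset.mem_erase.2 ⟨hxv, hx⟩) y (Finset.mem_erase.2 ⟨hyv, hy⟩) hxy
  obtain ⟨c, hc⟩ := key Finset.univ
  exact ⟨SimpleGraph.Coloring.mk c fun {x y} h => hc x (Finset.mem_univ x) y (Finset.mem_univ y) h⟩

/-- A proper 3-coloring gives the two nonadjacent vertices of a diamond the same color. -/
theorem IsDiamondCopy.color_eq {f : Fin 4 → V} (hf : IsDiamondCopy G f)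
    (c : G.Coloring (Fin 3)) : c (f 0) = c (f 1) := by
  have h02 := c.valid (@hf.2 0 2 (by simp [diamondGraph]))
  have h03 := c.valid (@hf.2 0 3 (by simp [diamondGraph]))
  have h12 := c.valid (@hf.2 1 2 (by simp [diamondGraph]))
  have h13 := c.valid (@hf.2 1 3 (by simp [diamondGraph]))
  have h23 := c.valid (@hf.2 2 3 (by simp [diamondGraph]))
  omega

end

theorem precoloring_diamond_vertices_same_color_connected
    {V : Type*} [Fintype V] (G : SimpleGraph V)
    (hout : G.Outerplanar) (hconn : G.Connected)
    (htri : {t : Finset V | G.IsNClique 3 t}.ncard = 2)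
    (f : Fin 4 → V) (hD : IsDiamondCopy G f)
    (c₀ : Fin 3) :
    ∃ c : G.Coloring (Fin 3), c (f 0) = c₀ ∧ c (f 1) = c₀ := by
  obtain ⟨c⟩ := SimpleGraph.colorable_three_of_not_hasMinor hout.1
  let σ : Fin 3 ↪ Fin 3 := (Equiv.swap (c (f 0)) c₀).toEmbedding
  refine ⟨(SimpleGraph.Embedding.completeGraph σ).toHom.comp c, ?_, ?_⟩
  · exact Equiv.swap_apply_left _ _
  · change Equiv.swap (c (f 0)) c₀ (c (f 1)) = c₀
    rw [← hD.color_eq c, Equiv.swap_apply_left]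
end
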